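/- arXiv:1112.4226 — 2 statements merged into one kernel-verified Lean document; each statement's English description precedes it below -/
import Mathlib

section
/- Product integral formula for Whittaker functions: let α, β, ν ∈ ℂ with 0 < Re ν < 1/2, α ≠ β, and with α + ν + 1/2 and β + ν + 1/2 not nonpositive integers. Then ∫₀^{∞} W_{α,ν}(y) · W_{β,ν}(y) · dy/y = (π / ((α−β)·sin(2πν))) · [ 1/(Γ(1/2−α+ν)·Γ(1/2−β−ν)) − 1/(Γ(1/2−α−ν)·Γ(1/2−β+ν)) ], the integral converging absolutely. -/
open MeasureTheory

/-- The Whittaker function W_{μ,ν}(y), defined for Re ν > 0, μ + ν + 1/2 not a nonpositive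
integer and y > 0 by the absolutely convergent integral
W_{μ,ν}(y) = e^{iπμ} Γ(μ+ν+1/2) π^{−1} (y/4)^{1/2−ν}
  ∫ e^{−iyξ/2} (ξ²+1)^{−ν−1/2} exp(μ(Log(ξ−i) − Log(ξ+i))) dξ. -/
noncomputable def Wh (μ ν : ℂ) (y : ℝ) : ℂ :=
  Complex.exp (Complex.I * (Real.pi : ℂ) * μ) * Complex.Gamma (μ + ν + 1 / 2) / (Real.pi : ℂ) *
    ((y / 4 : ℝ) : ℂ) ^ ((1 : ℂ) / 2 - ν) *
    ∫ ξ : ℝ,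
      Complex.exp (-Complex.I * (y : ℂ) * (ξ : ℂ) / 2) *
        ((ξ ^ 2 + 1 : ℝ) : ℂ) ^ (-ν - 1 / 2) *
        Complex.exp (μ * (Complex.log ((ξ : ℂ) - Complex.I) - Complex.log ((ξ : ℂ) + Complex.I)))

section Whittaker

open Complex Set Filter Topology Asymptotics

/-- The integrand `u^{b-1} (1+u)^{a-1} e^{-yu}` of Tricomi's integral. -/
noncomputable def tricomiIntegrand (a b : ℂ) (y u : ℝ) : ℂ :=
  (u : ℂ) ^ (b - 1) * (1 + (u : ℂ)) ^ (a - 1) * cexp (-(y * u))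

/-- Tricomi's integral `∫₀^∞ u^{b-1} (1+u)^{a-1} e^{-yu} du`. -/
noncomputable def tricomiIntegral (a b : ℂ) (y : ℝ) : ℂ :=
  ∫ u in Ioi (0 : ℝ), tricomiIntegrand a b y u

lemma norm_tricomiIntegrand (a b : ℂ) (y : ℝ) {u : ℝ} (hu : 0 < u) :
    ‖tricomiIntegrand a b y u‖ =
      u ^ (b.re - 1) * (1 + u) ^ (a.re - 1) * Real.exp (-(y * u)) := by
  have h1 : (1 + (u : ℂ)) = ((1 + u : ℝ) : ℂ) := by push_cast; rfl
  rw [tricomiIntegrand, norm_mul, norm_mul, h1, norm_cpow_eq_rpow_re_of_pos hu,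
    norm_cpow_eq_rpow_re_of_pos (by linarith), Complex.norm_exp]
  simp

lemma one_add_ofReal_mem_slitPlane {u : ℝ} (hu : 0 ≤ u) : 1 + (u : ℂ) ∈ slitPlane := by
  left
  simp only [add_re, one_re, ofReal_re]
  linarith

lemma one_add_ofReal_ne_zero {u : ℝ} (hu : 0 ≤ u) : 1 + (u : ℂ) ≠ 0 :=
  slitPlane_ne_zero (one_add_ofReal_mem_slitPlane hu)

lemma continuousOn_one_add_cpow_mul_exp (a : ℂ) (y : ℝ) :
    ContinuousOn (fun u : ℝ => (1 + (u : ℂ)) ^ (a - 1) * cexp (-(y * u))) (Ici 0) := by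
  intro u hu
  apply ContinuousAt.continuousWithinAt
  exact ((continuous_const.add continuous_ofReal).continuousAt.cpow continuousAt_const
    (one_add_ofReal_mem_slitPlane hu)).mul
    (by fun_prop)

lemma aestronglyMeasurable_tricomiIntegrand (a b : ℂ) (y : ℝ) :
    AEStronglyMeasurable (tricomiIntegrand a b y) (volume.restrict (Ioi 0)) := by
  unfold tricomiIntegrand
  exact (by fun_prop : Measurable _).aestronglyMeasurable

lemma isBigO_one_add_cpow_mul_exp_nhdsGT (a : ℂ) (y : ℝ) :
    (fun u : ℝ => (1 + (u : ℂ)) ^ (a - 1) * cexp (-(y * u))) =O[𝓝[>] 0]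
      (fun u : ℝ => u ^ (-(0 : ℝ))) := by
  simp only [neg_zero, Real.rpow_zero]
  exact ((continuousOn_one_add_cpow_mul_exp a y 0 self_mem_Ici).mono_left
    (nhdsWithin_mono _ Ioi_subset_Ici_self)).isBigO_one ℝ

lemma integrableOn_tricomiIntegrand {a b : ℂ} {y : ℝ} (hb : 0 < b.re) (hy : 0 < y) :
    IntegrableOn (tricomiIntegrand a b y) (Ioi 0) := by
  have key : MellinConvergent (fun u : ℝ => (1 + (u : ℂ)) ^ (a - 1) * cexp (-(y * u))) b := by
    refine mellinConvergent_of_isBigO_rpow_exp (half_pos hy)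
      (((continuousOn_one_add_cpow_mul_exp a y).mono Ioi_subset_Ici_self).locallyIntegrableOn
        measurableSet_Ioi) ?_ (isBigO_one_add_cpow_mul_exp_nhdsGT a y) hb
    have h1 := (isLittleO_rpow_exp_pos_mul_atTop (a.re - 1) (half_pos hy)).comp_tendsto
      (tendsto_atTop_add_const_left atTop (1 : ℝ) tendsto_id)
    have h2 := h1.isBigO.mul (isBigO_refl (fun u : ℝ => Real.exp (-(y * u))) atTop)
    have h3 : (fun u : ℝ => (1 + (u : ℂ)) ^ (a - 1) * cexp (-(y * u))) =O[atTop]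
        (fun u : ℝ => (1 + u) ^ (a.re - 1) * Real.exp (-(y * u))) := by
      refine IsBigO.of_bound 1 ?_
      filter_upwards [eventually_gt_atTop 0] with u hu
      have h1 : (1 + (u : ℂ)) = ((1 + u : ℝ) : ℂ) := by push_cast; rfl
      rw [norm_mul, h1, norm_cpow_eq_rpow_re_of_pos (by linarith), Complex.norm_exp, one_mul,
        Real.norm_of_nonneg (by positivity)]
      simp
    refine h3.trans (h2.trans ?_)
    refine IsBigO.of_bound (Real.exp (y / 2)) (Eventually.of_forall fun u => ?_)
    simp only [Function.comp, id]
    rw [Real.norm_of_nonneg (by positivity), Real.norm_of_nonneg (by positivity), ← Real.exp_add,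
      ← Real.exp_add]
    apply le_of_eq
    congr 1
    ring
  refine key.congr_fun (fun u _ => ?_) measurableSet_Ioi
  simp only [tricomiIntegrand, smul_eq_mul]
  ring

lemma integrableOn_tricomiIntegrand_zero {a b : ℂ} (hb : 0 < b.re) (hab : (a + b).re < 1)
    (ha : a.re ≤ 1) : IntegrableOn (tricomiIntegrand a b 0) (Ioi 0) := by
  have key : MellinConvergent (fun u : ℝ => (1 + (u : ℂ)) ^ (a - 1) * cexp (-((0 : ℝ) * u))) b := by
    refine mellinConvergent_of_isBigO_rpow (a := 1 - a.re)
      (((continuousOn_one_add_cpow_mul_exp a 0).mono Ioi_subset_Ici_self).locallyIntegrableOn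
        measurableSet_Ioi) ?_ (by simp at hab; linarith) (isBigO_one_add_cpow_mul_exp_nhdsGT a 0) hb
    refine IsBigO.of_bound 1 ?_
    filter_upwards [eventually_gt_atTop 0] with u hu
    have h1 : (1 + (u : ℂ)) = ((1 + u : ℝ) : ℂ) := by push_cast; rfl
    rw [norm_mul, h1, norm_cpow_eq_rpow_re_of_pos (by linarith), Complex.norm_exp, one_mul,
      Real.norm_of_nonneg (by positivity)]
    simp only [sub_re, one_re, neg_sub, ofReal_zero, zero_mul, neg_zero, zero_re, Real.exp_zero,
      mul_one]
    exact Real.rpow_le_rpow_of_nonpos hu (by linarith) (by linarith)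
  refine key.congr_fun (fun u _ => ?_) measurableSet_Ioi
  simp only [tricomiIntegrand, smul_eq_mul]
  ring

lemma tricomiIntegrand_mul_self (a b : ℂ) (y : ℝ) {u : ℝ} (hu : 0 < u) :
    tricomiIntegrand a b y u * u = tricomiIntegrand a (b + 1) y u := by
  have hu' : (u : ℂ) ≠ 0 := ofReal_ne_zero.2 hu.ne'
  have : (u : ℂ) ^ (b + 1 - 1) = (u : ℂ) ^ (b - 1) * u := by
    rw [show b + 1 - 1 = b - 1 + 1 by ring, cpow_add _ _ hu', cpow_one]
  rw [tricomiIntegrand, tricomiIntegrand, this]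
  ring

lemma tricomiIntegrand_mul_one_add (a b : ℂ) (y : ℝ) {u : ℝ} (hu : 0 < u) :
    tricomiIntegrand a b y u * (1 + u) = tricomiIntegrand (a + 1) b y u := by
  have : (1 + (u : ℂ)) ^ (a + 1 - 1) = (1 + (u : ℂ)) ^ (a - 1) * (1 + u) := by
    rw [show a + 1 - 1 = a - 1 + 1 by ring, cpow_add _ _ (one_add_ofReal_ne_zero hu.le), cpow_one]
  rw [tricomiIntegrand, tricomiIntegrand, this]
  ring

lemma tricomiIntegral_add_succ {a b : ℂ} {y : ℝ} (hb : 0 < b.re) (hy : 0 < y) :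
    tricomiIntegral a b y + tricomiIntegral a (b + 1) y = tricomiIntegral (a + 1) b y := by
  unfold tricomiIntegral
  rw [← integral_add (integrableOn_tricomiIntegrand hb hy)
    (integrableOn_tricomiIntegrand (by simp; linarith) hy)]
  refine setIntegral_congr_fun measurableSet_Ioi fun u hu => ?_
  rw [← tricomiIntegrand_mul_self _ _ _ hu, ← tricomiIntegrand_mul_one_add _ _ _ hu]
  ring

lemma hasDerivAt_tricomiIntegral {a b : ℂ} {y : ℝ} (hb : 0 < b.re) (hy : 0 < y) :
    HasDerivAt (tricomiIntegral a b) (-tricomiIntegral a (b + 1) y) y := by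
  have hb' : 0 < (b + 1).re := by simp; linarith
  have := (hasDerivAt_integral_of_dominated_loc_of_deriv_le
    (μ := volume.restrict (Ioi (0 : ℝ))) (F := tricomiIntegrand a b)
    (F' := fun x u => -tricomiIntegrand a (b + 1) x u) (x₀ := y)
    (bound := fun u => ‖tricomiIntegrand a (b + 1) (y / 2) u‖)
    (Metric.ball_mem_nhds y (half_pos hy))
    (Eventually.of_forall fun x => aestronglyMeasurable_tricomiIntegrand a b x)
    (integrableOn_tricomiIntegrand hb hy)
    (aestronglyMeasurable_tricomiIntegrand a (b + 1) y).neg ?_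
    (integrableOn_tricomiIntegrand hb' (half_pos hy)).norm ?_).2
  · rwa [integral_neg] at this
  · refine (ae_restrict_mem measurableSet_Ioi).mono fun u hu x hx => ?_
    have hu : 0 < u := hu
    rw [norm_neg, norm_tricomiIntegrand _ _ _ hu, norm_tricomiIntegrand _ _ _ hu]
    rw [Metric.mem_ball, Real.dist_eq, abs_lt] at hx
    have : y / 2 * u ≤ x * u := mul_le_mul_of_nonneg_right (by linarith) hu.le
    gcongr
  · refine (ae_restrict_mem measurableSet_Ioi).mono fun u hu x hx => ?_
    rw [← tricomiIntegrand_mul_self _ _ _ hu]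
    have h : HasDerivAt (fun x : ℝ => cexp (-(x * u))) (cexp (-(x * u)) * (-(1 * u))) x :=
      (((hasDerivAt_id x).ofReal_comp.mul_const (u : ℂ)).neg).cexp
    refine (h.const_mul ((u : ℂ) ^ (b - 1) * (1 + (u : ℂ)) ^ (a - 1))).congr_deriv ?_
    rw [tricomiIntegrand]
    ring

/-- Integration by parts for Tricomi's integral. -/
lemma tricomiIntegral_contiguous {a b : ℂ} {y : ℝ} (hb : 1 < b.re) (hy : 0 < y) :
    (b - 1) * tricomiIntegral (a + 1) (b - 1) y + a * tricomiIntegral a b y =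
      y * tricomiIntegral (a + 1) b y := by
  have i1 : IntegrableOn (tricomiIntegrand (a + 1) (b - 1) y) (Ioi 0) :=
    integrableOn_tricomiIntegrand (by simp; linarith) hy
  have i2 : IntegrableOn (tricomiIntegrand a b y) (Ioi 0) :=
    integrableOn_tricomiIntegrand (by linarith) hy
  have i3 : IntegrableOn (tricomiIntegrand (a + 1) b y) (Ioi 0) :=
    integrableOn_tricomiIntegrand (by linarith) hy
  have hd : ∀ u ∈ Ioi (0 : ℝ), HasDerivAt (tricomiIntegrand (a + 1) b y)
      ((b - 1) * tricomiIntegrand (a + 1) (b - 1) y u + a * tricomiIntegrand a b y u -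
        y * tricomiIntegrand (a + 1) b y u) u := by
    intro u hu
    have hu : 0 < u := hu
    have h1 : HasDerivAt (fun u : ℝ => (u : ℂ) ^ (b - 1)) ((b - 1) * (u : ℂ) ^ (b - 1 - 1)) u := by
      simpa using! ((hasDerivAt_id (u : ℂ)).cpow_const (c := b - 1)
        (ofReal_mem_slitPlane.2 hu)).comp_ofReal
    have h2 : HasDerivAt (fun u : ℝ => (1 + (u : ℂ)) ^ (a + 1 - 1))
        ((a + 1 - 1) * (1 + (u : ℂ)) ^ (a + 1 - 1 - 1)) u := by
      simpa using! (((hasDerivAt_id (u : ℂ)).const_add (1 : ℂ)).cpow_const (c := a + 1 - 1)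
        (one_add_ofReal_mem_slitPlane hu.le)).comp_ofReal
    have h3 : HasDerivAt (fun u : ℝ => cexp (-(y * u))) (cexp (-(y * u)) * (-(y * 1))) u :=
      (((hasDerivAt_id u).ofReal_comp.const_mul (y : ℂ)).neg).cexp
    refine ((h1.mul h2).mul h3).congr_deriv ?_
    simp only [tricomiIntegrand, add_sub_cancel_right, Pi.mul_apply]
    ring
  have hi := ((i1.const_mul (b - 1)).add (i2.const_mul a)).sub (i3.const_mul (y : ℂ))
  have h0 : ContinuousWithinAt (tricomiIntegrand (a + 1) b y) (Ici 0) 0 := by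
    have := (continuousAt_ofReal_cpow_const 0 (b - 1) (Or.inl (by simp; linarith))
      ).continuousWithinAt (s := Ici 0) |>.mul
        (continuousOn_one_add_cpow_mul_exp (a + 1) y 0 self_mem_Ici)
    refine this.congr (fun u _ => ?_) ?_ <;>
      simp only [tricomiIntegrand, mul_assoc, Pi.mul_apply]
  have := integral_Ioi_of_hasDerivAt_of_tendsto h0 hd hi
    (tendsto_zero_of_hasDerivAt_of_integrableOn_Ioi hd hi i3)
  rw [integral_sub (f := fun u => (b - 1) * tricomiIntegrand (a + 1) (b - 1) y u +
      a * tricomiIntegrand a b y u) ((i1.const_mul (b - 1)).add (i2.const_mul a))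
      (i3.const_mul (y : ℂ)), integral_add (i1.const_mul (b - 1)) (i2.const_mul a),
    integral_const_mul, integral_const_mul, integral_const_mul] at this
  have h00 : tricomiIntegrand (a + 1) b y 0 = 0 := by
    rw [tricomiIntegrand, ofReal_zero, zero_cpow, zero_mul, zero_mul]
    intro h
    rw [sub_eq_zero.1 h] at hb
    simp at hb
  rw [h00, sub_zero] at this
  exact sub_eq_zero.1 this

lemma image_div_one_add_Ioi : (fun u : ℝ => u / (1 + u)) '' Ioi 0 = Ioo 0 1 := by
  ext x
  simp only [mem_image, mem_Ioi, mem_Ioo]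
  constructor
  · rintro ⟨u, hu, rfl⟩
    exact ⟨by positivity, by rw [div_lt_one (by positivity)]; linarith⟩
  · rintro ⟨h0, h1⟩
    have : 1 - x ≠ 0 := by linarith
    refine ⟨x / (1 - x), div_pos h0 (by linarith), ?_⟩
    field_simp
    ring

lemma tricomiIntegral_zero {b c : ℂ} (hb : 0 < b.re) (hc : 0 < c.re) :
    tricomiIntegral (1 - b - c) b 0 = Gamma b * Gamma c / Gamma (b + c) := by
  rw [← Complex.betaIntegral_eq_Gamma_mul_div b c hb hc, betaIntegral,
    intervalIntegral.integral_of_le zero_le_one, integral_Ioc_eq_integral_Ioo,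
    ← image_div_one_add_Ioi,
    integral_image_eq_integral_abs_deriv_smul (f := fun u : ℝ => u / (1 + u))
      (f' := fun u : ℝ => 1 / (1 + u) ^ 2) measurableSet_Ioi]
  · refine setIntegral_congr_fun measurableSet_Ioi fun u hu => ?_
    have hu : 0 < u := hu
    have h1 : 0 < 1 + u := by linarith
    have e0 : (1 + (u : ℂ)) = ((1 + u : ℝ) : ℂ) := by push_cast; rfl
    have h1' : ((1 + u : ℝ) : ℂ) ≠ 0 := ofReal_ne_zero.2 h1.ne'
    have e1 : (1 : ℂ) - ((u / (1 + u) : ℝ) : ℂ) = ((1 / (1 + u) : ℝ) : ℂ) := by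
      rw [← ofReal_one, ← ofReal_sub]
      congr 1
      field_simp
      ring
    have e2 : (|1 / (1 + u) ^ 2| : ℝ) = (1 + u) ^ (-2 : ℝ) := by
      rw [abs_of_pos (by positivity), Real.rpow_neg h1.le, one_div]
      norm_num
    simp only [tricomiIntegrand]
    rw [e0, e1, e2, div_eq_mul_inv u, ofReal_mul, mul_cpow_ofReal_nonneg hu.le (by positivity),
      one_div, ← Real.rpow_neg_one, ofReal_cpow h1.le, real_smul, ofReal_cpow h1.le]
    simp only [ofReal_zero, zero_mul, neg_zero, Complex.exp_zero, mul_one]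
    have e3 (w : ℂ) : (((1 + u : ℝ) : ℂ) ^ (((-1 : ℝ)) : ℂ)) ^ w = ((1 + u : ℝ) : ℂ) ^ (-w) := by
      rw [ofReal_neg, ofReal_one, cpow_neg_one, inv_cpow _ _, ← cpow_neg]
      rw [arg_ofReal_of_nonneg h1.le]
      exact Real.pi_pos.ne
    rw [e3, e3, mul_assoc, mul_left_comm, ← cpow_add _ _ h1', ← cpow_add _ _ h1']
    congr 2
    push_cast
    ring
  · intro u hu
    have hu : 0 < u := hu
    have h1 : 1 + u ≠ 0 := by linarith
    refine (((hasDerivAt_id u).div ((hasDerivAt_id u).const_add 1) h1).congr_deriv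
      ?_).hasDerivWithinAt
    simp
  · intro u hu v hv h
    have hu : 0 < u := hu
    have hv : 0 < v := hv
    simp only at h
    rw [div_eq_div_iff (by linarith) (by linarith)] at h
    linarith

lemma tendsto_tricomiIntegral_nhdsGT_zero {a b : ℂ} (hb : 0 < b.re) (hab : (a + b).re < 1)
    (ha : a.re ≤ 1) :
    Tendsto (tricomiIntegral a b) (𝓝[>] 0) (𝓝 (tricomiIntegral a b 0)) := by
  refine tendsto_integral_filter_of_dominated_convergence
    (fun u => ‖tricomiIntegrand a b 0 u‖)
    (Eventually.of_forall fun x => aestronglyMeasurable_tricomiIntegrand a b x) ?_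
    (integrableOn_tricomiIntegrand_zero hb hab ha).norm ?_
  · filter_upwards [self_mem_nhdsWithin] with y hy
    refine (ae_restrict_mem measurableSet_Ioi).mono fun u hu => ?_
    have hu : 0 < u := hu
    have hy : 0 < y := hy
    rw [norm_tricomiIntegrand _ _ _ hu, norm_tricomiIntegrand _ _ _ hu]
    have : 0 * u ≤ y * u := mul_le_mul_of_nonneg_right hy.le hu.le
    gcongr
  · refine Eventually.of_forall fun u => ?_
    have : Continuous fun y : ℝ => tricomiIntegrand a b y u := by
      unfold tricomiIntegrand
      fun_prop
    exact this.continuousAt.tendsto.mono_left nhdsWithin_le_nhds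

lemma norm_one_add_cpow_sub_cpow_le {c : ℂ} (hc : c.re ≤ 1) {u : ℝ} (hu : 0 < u) :
    ‖(1 + (u : ℂ)) ^ c - (u : ℂ) ^ c‖ ≤ ‖c‖ * u ^ (c.re - 1) := by
  have := norm_image_sub_le_of_norm_deriv_le_segment' (f := fun x : ℝ => (x : ℂ) ^ c)
    (f' := fun x : ℝ => c * (x : ℂ) ^ (c - 1)) (a := u) (b := u + 1) (C := ‖c‖ * u ^ (c.re - 1))
    (fun x hx => ?_) (fun x hx => ?_) (u + 1) ⟨by linarith, le_rfl⟩
  · simpa [add_comm] using this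
  · have hx : 0 < x := hu.trans_le hx.1
    simpa using! ((hasDerivAt_id (x : ℂ)).cpow_const (c := c)
      (ofReal_mem_slitPlane.2 hx)).comp_ofReal.hasDerivWithinAt
  · have hx' : 0 < x := hu.trans_le hx.1
    rw [norm_mul, norm_cpow_eq_rpow_re_of_pos hx']
    gcongr
    rw [sub_re, one_re]
    exact Real.rpow_le_rpow_of_nonpos hu hx.1 (by linarith)

lemma integral_cpow_mul_exp_neg {s : ℂ} (hs : 0 < s.re) {y : ℝ} (hy : 0 < y) :
    ∫ u in Ioi (0 : ℝ), (u : ℂ) ^ (s - 1) * cexp (-(y * u)) = Gamma s * (y : ℂ) ^ (-s) := by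
  rw [Complex.integral_cpow_mul_exp_neg_mul_Ioi hs (by simpa using hy), one_div, inv_cpow,
    ← cpow_neg, mul_comm]
  rw [arg_ofReal_of_nonneg hy.le]
  exact Real.pi_pos.ne

lemma tricomiIntegrand_one (s : ℂ) (y u : ℝ) :
    tricomiIntegrand 1 s y u = (u : ℂ) ^ (s - 1) * cexp (-(y * u)) := by
  simp [tricomiIntegrand]

lemma tricomiIntegral_one {s : ℂ} (hs : 0 < s.re) {y : ℝ} (hy : 0 < y) :
    tricomiIntegral 1 s y = Gamma s * (y : ℂ) ^ (-s) := by
  rw [← integral_cpow_mul_exp_neg hs hy, tricomiIntegral]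
  simp only [tricomiIntegrand_one]

lemma norm_tricomiIntegral_sub_le {a b : ℂ} (hb : 0 < b.re) (ha : a.re ≤ 2)
    (hab : 1 < (a + b).re) {y : ℝ} (hy : 0 < y) :
    ‖tricomiIntegral a (b + 1) y - Gamma (a + b) * (y : ℂ) ^ (-(a + b))‖ ≤
      ‖a - 1‖ * (Real.Gamma ((a + b).re - 1) * y ^ (1 - (a + b).re)) := by
  have hab' : 0 < (a + b).re := by linarith
  have hb' : 0 < (b + 1).re := by simp; linarith
  have hR : ∫ u in Ioi (0 : ℝ), ‖a - 1‖ * (u ^ ((a + b).re - 1 - 1) * Real.exp (-(y * u))) =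
      ‖a - 1‖ * (Real.Gamma ((a + b).re - 1) * y ^ (1 - (a + b).re)) := by
    rw [integral_const_mul, Real.integral_rpow_mul_exp_neg_mul_Ioi (by linarith) hy, one_div,
      ← Real.rpow_neg_one, ← Real.rpow_mul hy.le]
    ring_nf
  have i0 : IntegrableOn (fun u => u ^ ((a + b).re - 1 - 1) * Real.exp (-(y * u))) (Ioi 0) := by
    have : IntegrableOn (fun u => ‖tricomiIntegrand 1 (a + b - 1) y u‖) (Ioi 0) :=
      (integrableOn_tricomiIntegrand (by simp at hab ⊢; linarith) hy).norm
    refine this.congr_fun (fun u hu => ?_) measurableSet_Ioi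
    simp only [norm_tricomiIntegrand _ _ _ hu]
    simp
  rw [← tricomiIntegral_one hab' hy, ← hR, tricomiIntegral, tricomiIntegral, ← integral_sub
    (integrableOn_tricomiIntegrand hb' hy) (integrableOn_tricomiIntegrand hab' hy)]
  refine norm_integral_le_of_norm_le (i0.const_mul _) ?_
  refine (ae_restrict_mem measurableSet_Ioi).mono fun u hu => ?_
  have hu : 0 < u := hu
  have hu' : (u : ℂ) ≠ 0 := ofReal_ne_zero.2 hu.ne'
  have e : tricomiIntegrand a (b + 1) y u - tricomiIntegrand 1 (a + b) y u =
      (u : ℂ) ^ b * ((1 + (u : ℂ)) ^ (a - 1) - (u : ℂ) ^ (a - 1)) * cexp (-(y * u)) := by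
    rw [tricomiIntegrand_one, tricomiIntegrand, show a + b - 1 = b + (a - 1) by ring,
      cpow_add _ _ hu', add_sub_cancel_right]
    ring
  have e2 : ‖cexp (-(y * u))‖ = Real.exp (-(y * u)) := by
    rw [Complex.norm_exp]; simp
  have e3 : u ^ ((a + b).re - 1 - 1) = u ^ b.re * u ^ ((a - 1).re - 1) := by
    rw [← Real.rpow_add hu]; congr 1; simp; ring
  rw [e, norm_mul, norm_mul, e2, e3, norm_cpow_eq_rpow_re_of_pos hu]
  have := norm_one_add_cpow_sub_cpow_le (c := a - 1) (by simp; linarith) hu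
  calc _ ≤ u ^ b.re * (‖a - 1‖ * u ^ ((a - 1).re - 1)) * Real.exp (-(y * u)) := by gcongr
    _ = _ := by ring

/-- Expansion of Tricomi's integral at the origin. -/
lemma tendsto_tricomiIntegral_sub {a b s : ℂ} (hb : 0 < b.re) (hs : a + b = 1 + s)
    (hs0 : 0 < s.re) (hs1 : s.re < 1) :
    Tendsto (fun y : ℝ => tricomiIntegral a b y - Gamma s * (y : ℂ) ^ (-s)) (𝓝[>] 0)
      (𝓝 (Gamma b * Gamma (-s) / Gamma (1 - a))) := by
  have hsne : s ≠ 0 := fun h => by simp [h] at hs0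
  have hre : a.re + b.re = 1 + s.re := by simpa using congrArg re hs
  have t1 : Tendsto (fun y : ℝ => (a - 1) * tricomiIntegral (a - 1) b y / s) (𝓝[>] 0)
      (𝓝 ((a - 1) * tricomiIntegral (a - 1) b 0 / s)) :=
    ((tendsto_tricomiIntegral_nhdsGT_zero hb (by simp; linarith)
      (by simp; linarith)).const_mul _).div_const _
  have t2 : Tendsto (fun y : ℝ => (y * tricomiIntegral a (b + 1) y -
      s * (Gamma s * (y : ℂ) ^ (-s))) / s) (𝓝[>] 0) (𝓝 (0 / s)) := by
    refine Tendsto.div_const ?_ _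
    have hbd : Tendsto (fun y : ℝ => ‖a - 1‖ * (Real.Gamma (s.re) * y ^ (1 - s.re))) (𝓝[>] 0)
        (𝓝 0) := by
      have : Tendsto (fun y : ℝ => y ^ (1 - s.re)) (𝓝[>] 0) (𝓝 0) := by
        have := (Real.continuousAt_rpow_const 0 (1 - s.re) (Or.inr (by linarith))).tendsto
        rw [Real.zero_rpow (by linarith)] at this
        exact this.mono_left nhdsWithin_le_nhds
      simpa using (this.const_mul (Real.Gamma s.re)).const_mul ‖a - 1‖
    refine squeeze_zero_norm' ?_ hbd
    filter_upwards [self_mem_nhdsWithin] with y hy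
    have hy : 0 < y := hy
    have hy' : (y : ℂ) ≠ 0 := ofReal_ne_zero.2 hy.ne'
    have h := norm_tricomiIntegral_sub_le hb (by linarith) (by simp; linarith) hy (a := a)
    have e : y * tricomiIntegral a (b + 1) y - s * (Gamma s * (y : ℂ) ^ (-s)) =
        y * (tricomiIntegral a (b + 1) y - Gamma (a + b) * (y : ℂ) ^ (-(a + b))) := by
      have : (y : ℂ) ^ (-s) = y * (y : ℂ) ^ (-(a + b)) := by
        rw [hs, show -s = -(1 + s) + 1 by ring, cpow_add _ _ hy', cpow_one, mul_comm]
      rw [this, hs, add_comm 1 s, Gamma_add_one s hsne]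
      ring
    rw [e, norm_mul, norm_real, Real.norm_of_nonneg hy.le]
    calc _ ≤ y * _ := mul_le_mul_of_nonneg_left h hy.le
      _ = _ := by
        have e1 : (a + b).re - 1 = s.re := by simp; linarith
        have e2 : 1 - s.re = 1 - (a + b).re + 1 := by simp; linarith
        rw [e1, e2, Real.rpow_add_one hy.ne']
        ring
  have t := t1.add t2
  have hval : (a - 1) * tricomiIntegral (a - 1) b 0 / s + 0 / s =
      Gamma b * Gamma (-s) / Gamma (1 - a) := by
    have e0 : a - 1 = 1 - b - (1 - s) := by linear_combination hs
    have e1 : tricomiIntegral (a - 1) b 0 = Gamma b * Gamma (1 - s) / Gamma (1 - a + 1) := by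
      conv_lhs => rw [e0]
      rw [tricomiIntegral_zero hb (by simp; linarith)]
      congr 2
      linear_combination hs
    have e2 : Gamma (1 - s) = -s * Gamma (-s) := by
      rw [← Gamma_add_one _ (neg_ne_zero.2 hsne)]
      congr 1
      ring
    rw [e1, e2]
    by_cases h : 1 - a = 0
    · rw [h, Gamma_zero, show a - 1 = 0 by linear_combination -h]
      simp
    · rw [Gamma_add_one _ h]
      have : a - 1 = -(1 - a) := by ring
      rw [this]
      by_cases hG : Gamma (1 - a) = 0
      · simp [hG]
      · field_simp
        ring
  rw [hval] at t
  refine t.congr' ?_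
  filter_upwards [self_mem_nhdsWithin] with y hy
  have hy : 0 < y := hy
  have h1 := tricomiIntegral_contiguous (a := a - 1) (b := b + 1) (by simpa using hb) hy
  have h2 := tricomiIntegral_add_succ (a := a - 1) hb hy
  rw [sub_add_cancel, add_sub_cancel_right] at h1
  rw [sub_add_cancel] at h2
  field_simp
  linear_combination -h1 + (a - 1) * h2 + tricomiIntegral a b y * hs

/-- The integrand `e^{-iyξ/2} (1+iξ)^{-b} (1-iξ)^{-a}`. -/
noncomputable def whittakerFourierIntegrand (a b : ℂ) (y ξ : ℝ) : ℂ :=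
  cexp (-I * y * ξ / 2) * (1 + ξ * I) ^ (-b) * (1 - ξ * I) ^ (-a)

/-- The Fourier integral `∫ e^{-iyξ/2} (1+iξ)^{-b} (1-iξ)^{-a} dξ`. -/
noncomputable def whittakerFourier (a b : ℂ) (y : ℝ) : ℂ :=
  ∫ ξ : ℝ, whittakerFourierIntegrand a b y ξ

lemma one_add_mul_I_mem_slitPlane (ξ : ℝ) : 1 + ξ * I ∈ slitPlane := by
  left; simp

lemma one_sub_mul_I_mem_slitPlane (ξ : ℝ) : 1 - ξ * I ∈ slitPlane := by
  left; simp

lemma one_add_mul_I_ne_zero (ξ : ℝ) : 1 + ξ * I ≠ 0 :=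
  slitPlane_ne_zero (one_add_mul_I_mem_slitPlane ξ)

lemma one_sub_mul_I_ne_zero (ξ : ℝ) : 1 - ξ * I ≠ 0 :=
  slitPlane_ne_zero (one_sub_mul_I_mem_slitPlane ξ)

lemma norm_cpow_le_exp_pi (z w : ℂ) :
    ‖z ^ w‖ ≤ ‖z‖ ^ w.re * Real.exp (Real.pi * |w.im|) := by
  refine (norm_cpow_le z w).trans ?_
  rw [div_eq_mul_inv, ← Real.exp_neg]
  gcongr
  calc -(z.arg * w.im) ≤ |z.arg * w.im| := neg_le_abs _
    _ = |z.arg| * |w.im| := abs_mul _ _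
    _ ≤ _ := by gcongr; exact abs_arg_le_pi z

lemma norm_one_add_mul_I_rpow (ξ r : ℝ) : ‖1 + (ξ : ℂ) * I‖ ^ r = (1 + ‖ξ‖ ^ 2) ^ (r / 2) := by
  have : ‖1 + (ξ : ℂ) * I‖ = (1 + ‖ξ‖ ^ 2) ^ (1 / 2 : ℝ) := by
    rw [← Real.sqrt_eq_rpow, ← ofReal_one, norm_add_mul_I]
    simp
  rw [this, ← Real.rpow_mul (by positivity)]
  congr 1
  ring

lemma norm_one_sub_mul_I_rpow (ξ r : ℝ) : ‖1 - (ξ : ℂ) * I‖ ^ r = (1 + ‖ξ‖ ^ 2) ^ (r / 2) := by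
  have := norm_one_add_mul_I_rpow (-ξ) r
  rw [norm_neg] at this
  rw [← this]
  congr 2
  push_cast
  ring

lemma integrable_whittakerFourierIntegrand {a b : ℂ} (hab : 1 < (a + b).re) (y : ℝ) :
    Integrable (whittakerFourierIntegrand a b y) := by
  have hi := (integrable_rpow_neg_one_add_norm_sq (E := ℝ) (μ := volume) (r := (a + b).re)
    (by simpa using hab)).const_mul
      (Real.exp (Real.pi * |(-b).im|) * Real.exp (Real.pi * |(-a).im|))
  refine hi.mono' ?_ (Eventually.of_forall fun ξ => ?_)
  · unfold whittakerFourierIntegrand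
    exact (by fun_prop : Measurable _).aestronglyMeasurable
  · have h1 : ‖cexp (-I * y * ξ / 2)‖ = 1 := by
      rw [Complex.norm_exp]; simp
    rw [whittakerFourierIntegrand, norm_mul, norm_mul, h1, one_mul]
    calc _ ≤ (‖1 + (ξ : ℂ) * I‖ ^ (-b).re * Real.exp (Real.pi * |(-b).im|)) *
          (‖1 - (ξ : ℂ) * I‖ ^ (-a).re * Real.exp (Real.pi * |(-a).im|)) := by
          gcongr <;> exact norm_cpow_le_exp_pi _ _
      _ = _ := by
        have : -(a + b).re / 2 = (-b).re / 2 + (-a).re / 2 := by simp; ring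
        rw [norm_one_add_mul_I_rpow, norm_one_sub_mul_I_rpow, this,
          Real.rpow_add (by positivity)]
        ring

lemma whittakerFourier_pred_add_pred {a b : ℂ} (hab : 2 < (a + b).re) (y : ℝ) :
    whittakerFourier a (b - 1) y + whittakerFourier (a - 1) b y = 2 * whittakerFourier a b y := by
  unfold whittakerFourier
  rw [← integral_add (integrable_whittakerFourierIntegrand (by simp at hab ⊢; linarith) y)
    (integrable_whittakerFourierIntegrand (by simp at hab ⊢; linarith) y), ← integral_const_mul]
  congr 1
  ext ξ
  simp only [whittakerFourierIntegrand]
  rw [show -(b - 1) = -b + 1 by ring, show -(a - 1) = -a + 1 by ring,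
    cpow_add _ _ (one_add_mul_I_ne_zero ξ), cpow_add _ _ (one_sub_mul_I_ne_zero ξ), cpow_one,
    cpow_one]
  ring

/-- Integration by parts for the Fourier integral. -/
lemma whittakerFourier_contiguous {a b : ℂ} (hab : 1 < (a + b).re) (y : ℝ) :
    y / 2 * whittakerFourier a b y =
      a * whittakerFourier (a + 1) b y - b * whittakerFourier a (b + 1) y := by
  have i1 := integrable_whittakerFourierIntegrand hab y
  have i2 := integrable_whittakerFourierIntegrand (a := a + 1) (b := b)
    (by simp at hab ⊢; linarith) y
  have i3 := integrable_whittakerFourierIntegrand (a := a) (b := b + 1)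
    (by simp at hab ⊢; linarith) y
  have hd : ∀ ξ : ℝ, HasDerivAt (whittakerFourierIntegrand a b y)
      (I * a * whittakerFourierIntegrand (a + 1) b y ξ -
        I * b * whittakerFourierIntegrand a (b + 1) y ξ -
        I * y / 2 * whittakerFourierIntegrand a b y ξ) ξ := by
    intro ξ
    have h1 : HasDerivAt (fun ξ : ℝ => cexp (-I * y * ξ / 2))
        (cexp (-I * y * ξ / 2) * (-I * y * 1 / 2)) ξ :=
      (((hasDerivAt_id (ξ : ℂ)).const_mul (-I * y)).div_const 2).cexp.comp_ofReal
    have h2 : HasDerivAt (fun ξ : ℝ => (1 + (ξ : ℂ) * I) ^ (-b))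
        ((-b) * (1 + (ξ : ℂ) * I) ^ (-b - 1) * (1 * I)) ξ :=
      ((((hasDerivAt_id (ξ : ℂ)).mul_const I).const_add 1).cpow_const
        (one_add_mul_I_mem_slitPlane ξ)).comp_ofReal
    have h3 : HasDerivAt (fun ξ : ℝ => (1 - (ξ : ℂ) * I) ^ (-a))
        ((-a) * (1 - (ξ : ℂ) * I) ^ (-a - 1) * (-(1 * I))) ξ :=
      ((((hasDerivAt_id (ξ : ℂ)).mul_const I).const_sub 1).cpow_const
        (one_sub_mul_I_mem_slitPlane ξ)).comp_ofReal
    refine ((h1.mul h2).mul h3).congr_deriv ?_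
    simp only [whittakerFourierIntegrand, Pi.mul_apply]
    rw [show -(b + 1) = -b - 1 by ring, show -(a + 1) = -a - 1 by ring]
    ring
  have hi := ((i2.const_mul (I * a)).sub (i3.const_mul (I * b))).sub (i1.const_mul (I * y / 2))
  have := integral_eq_zero_of_hasDerivAt_of_integrable hd hi i1
  rw [integral_sub (f := fun ξ => I * a * whittakerFourierIntegrand (a + 1) b y ξ -
      I * b * whittakerFourierIntegrand a (b + 1) y ξ)
      ((i2.const_mul (I * a)).sub (i3.const_mul (I * b))) (i1.const_mul (I * y / 2)),
    integral_sub (i2.const_mul (I * a)) (i3.const_mul (I * b)),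
    integral_const_mul, integral_const_mul, integral_const_mul] at this
  unfold whittakerFourier
  linear_combination I * this + (-a * (∫ ξ, whittakerFourierIntegrand (a + 1) b y ξ) +
    b * (∫ ξ, whittakerFourierIntegrand a (b + 1) y ξ) +
    y / 2 * ∫ ξ, whittakerFourierIntegrand a b y ξ) * I_sq

lemma whittakerFourier_three_term {a b : ℂ} (hab : 1 < (a + b).re) (y : ℝ) :
    a * whittakerFourier (a + 1) (b - 1) y =
      (y - a + b) * whittakerFourier a b y + b * whittakerFourier (a - 1) (b + 1) y := by
  have h1 := whittakerFourier_contiguous hab y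
  have h2 := whittakerFourier_pred_add_pred (a := a + 1) (b := b)
    (by simp at hab ⊢; linarith) y
  have h3 := whittakerFourier_pred_add_pred (a := a) (b := b + 1)
    (by simp at hab ⊢; linarith) y
  rw [add_sub_cancel_right] at h2 h3
  linear_combination a * h2 - b * h3 - 2 * h1

section FourierInversion

open scoped FourierTransform Real

/-- The density `t^{a-1} e^{-t}` on `(0, ∞)`, extended by zero. -/
noncomputable def gammaKernel (a : ℂ) : ℝ → ℂ :=
  indicator (Ioi 0) fun t => (t : ℂ) ^ (a - 1) * cexp (-t)

lemma integrable_gammaKernel {a : ℂ} (ha : 0 < a.re) : Integrable (gammaKernel a) := by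
  rw [gammaKernel, integrable_indicator_iff measurableSet_Ioi]
  refine (integrableOn_tricomiIntegrand (a := 1) ha one_pos).congr_fun (fun t _ => ?_)
    measurableSet_Ioi
  simp [tricomiIntegrand]

lemma integrableOn_cpow_mul_exp_neg_one_add_mul_I {a : ℂ} (ha : 0 < a.re) (v : ℝ) :
    IntegrableOn (fun t : ℝ => (t : ℂ) ^ (a - 1) * cexp (-((1 + v * I) * t))) (Ioi 0) := by
  have hm : Measurable fun t : ℝ => (t : ℂ) ^ (a - 1) * cexp (-((1 + v * I) * t)) := by fun_prop
  refine Integrable.mono (integrableOn_tricomiIntegrand (a := 1) ha one_pos) hm.aestronglyMeasurable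
    (Eventually.of_forall fun t => ?_)
  simp [tricomiIntegrand, Complex.norm_exp]

lemma hasDerivAt_integral_cpow_mul_exp_neg_one_add_mul_I {a : ℂ} (ha : 0 < a.re) (v : ℝ) :
    HasDerivAt (fun v : ℝ => ∫ t in Ioi (0 : ℝ), (t : ℂ) ^ (a - 1) * cexp (-((1 + v * I) * t)))
      (-I * ∫ t in Ioi (0 : ℝ), (t : ℂ) ^ (a + 1 - 1) * cexp (-((1 + v * I) * t))) v := by
  have ha' : 0 < (a + 1).re := by simp; linarith
  have := (hasDerivAt_integral_of_dominated_loc_of_deriv_le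
    (μ := volume.restrict (Ioi (0 : ℝ)))
    (F := fun (v t : ℝ) => (t : ℂ) ^ (a - 1) * cexp (-((1 + v * I) * t)))
    (F' := fun (v t : ℝ) => -I * ((t : ℂ) ^ (a + 1 - 1) * cexp (-((1 + v * I) * t)))) (x₀ := v)
    (bound := fun t => ‖(t : ℂ) ^ (a + 1 - 1) * cexp (-((1 + (0 : ℝ) * I) * t))‖)
    (Metric.ball_mem_nhds v one_pos)
    (Eventually.of_forall fun x =>
      (integrableOn_cpow_mul_exp_neg_one_add_mul_I ha x).aestronglyMeasurable)
    (integrableOn_cpow_mul_exp_neg_one_add_mul_I ha v)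
    ((integrableOn_cpow_mul_exp_neg_one_add_mul_I ha' v).const_mul (-I)).aestronglyMeasurable ?_
    (integrableOn_cpow_mul_exp_neg_one_add_mul_I ha' 0).norm ?_).2
  · rwa [integral_const_mul] at this
  · refine Eventually.of_forall fun t x _ => ?_
    simp [Complex.norm_exp]
  · refine (ae_restrict_mem measurableSet_Ioi).mono fun t ht x _ => ?_
    have ht : 0 < t := ht
    have ht' : (t : ℂ) ≠ 0 := ofReal_ne_zero.2 ht.ne'
    have h : HasDerivAt (fun x : ℝ => cexp (-((1 + x * I) * t)))
        (cexp (-((1 + x * I) * t)) * (-(1 * I * t))) x :=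
      (((((hasDerivAt_id (x : ℂ)).mul_const I).const_add 1).mul_const (t : ℂ)).neg).cexp.comp_ofReal
    refine (h.const_mul ((t : ℂ) ^ (a - 1))).congr_deriv ?_
    rw [show a + 1 - 1 = a - 1 + 1 by ring, cpow_add _ _ ht', cpow_one]
    ring

lemma integral_cpow_succ_mul_exp_neg_one_add_mul_I {a : ℂ} (ha : 0 < a.re) (v : ℝ) :
    (1 + v * I) * ∫ t in Ioi (0 : ℝ), (t : ℂ) ^ (a + 1 - 1) * cexp (-((1 + v * I) * t)) =
      a * ∫ t in Ioi (0 : ℝ), (t : ℂ) ^ (a - 1) * cexp (-((1 + v * I) * t)) := by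
  have ha' : 0 < (a + 1).re := by simp; linarith
  have ha0 : a ≠ 0 := by rintro rfl; simp at ha
  have i1 := integrableOn_cpow_mul_exp_neg_one_add_mul_I ha v
  have i2 := integrableOn_cpow_mul_exp_neg_one_add_mul_I ha' v
  have hd : ∀ t ∈ Ioi (0 : ℝ),
      HasDerivAt (fun t : ℝ => (t : ℂ) ^ (a + 1 - 1) * cexp (-((1 + v * I) * t)))
      (a * ((t : ℂ) ^ (a - 1) * cexp (-((1 + v * I) * t))) -
        (1 + v * I) * ((t : ℂ) ^ (a + 1 - 1) * cexp (-((1 + v * I) * t)))) t := by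
    intro t ht
    have ht : 0 < t := ht
    have h1 : HasDerivAt (fun t : ℝ => (t : ℂ) ^ (a + 1 - 1))
        ((a + 1 - 1) * (t : ℂ) ^ (a + 1 - 1 - 1) * 1) t :=
      ((hasDerivAt_id (t : ℂ)).cpow_const (c := a + 1 - 1) (ofReal_mem_slitPlane.2 ht)).comp_ofReal
    have h2 : HasDerivAt (fun t : ℝ => cexp (-((1 + v * I) * t)))
        (cexp (-((1 + v * I) * t)) * (-((1 + v * I) * 1))) t :=
      ((((hasDerivAt_id (t : ℂ)).const_mul (1 + (v : ℂ) * I)).neg).cexp).comp_ofReal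
    refine (h1.mul h2).congr_deriv ?_
    simp only [add_sub_cancel_right]
    ring
  have hi := (i1.const_mul a).sub (i2.const_mul (1 + (v : ℂ) * I))
  have h0 : ContinuousWithinAt
      (fun t : ℝ => (t : ℂ) ^ (a + 1 - 1) * cexp (-((1 + v * I) * t))) (Ici 0) 0 := by
    refine ContinuousAt.continuousWithinAt ?_
    exact (continuousAt_ofReal_cpow_const 0 (a + 1 - 1) (Or.inl (by simpa using ha))).mul
      (by fun_prop)
  have := integral_Ioi_of_hasDerivAt_of_tendsto h0 hd hi
    (tendsto_zero_of_hasDerivAt_of_integrableOn_Ioi hd hi i2)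
  rw [integral_sub (i1.const_mul a) (i2.const_mul (1 + (v : ℂ) * I)),
    integral_const_mul, integral_const_mul] at this
  rw [ofReal_zero, zero_cpow (by simpa using ha0), zero_mul, sub_zero] at this
  exact (sub_eq_zero.1 this).symm

lemma integral_cpow_mul_exp_neg_one_add_mul_I {a : ℂ} (ha : 0 < a.re) (v : ℝ) :
    ∫ t in Ioi (0 : ℝ), (t : ℂ) ^ (a - 1) * cexp (-((1 + v * I) * t)) =
      Gamma a * (1 + v * I) ^ (-a) := by
  set G : ℝ → ℂ := fun v => (1 + (v : ℂ) * I) ^ a *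
    ∫ t in Ioi (0 : ℝ), (t : ℂ) ^ (a - 1) * cexp (-((1 + v * I) * t)) with hG
  have hd : ∀ x, HasDerivAt G 0 x := by
    intro x
    have h2 : HasDerivAt (fun ξ : ℝ => (1 + (ξ : ℂ) * I) ^ a)
        (a * (1 + (x : ℂ) * I) ^ (a - 1) * (1 * I)) x :=
      ((((hasDerivAt_id (x : ℂ)).mul_const I).const_add 1).cpow_const
        (one_add_mul_I_mem_slitPlane x)).comp_ofReal
    refine (h2.mul (hasDerivAt_integral_cpow_mul_exp_neg_one_add_mul_I ha x)).congr_deriv ?_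
    have h3 := integral_cpow_succ_mul_exp_neg_one_add_mul_I ha x
    have h4 : (1 + (x : ℂ) * I) ^ a = (1 + (x : ℂ) * I) ^ (a - 1) * (1 + (x : ℂ) * I) := by
      nth_rw 1 [show a = a - 1 + 1 by ring]
      rw [cpow_add _ _ (one_add_mul_I_ne_zero x), cpow_one]
    rw [h4]
    linear_combination -I * (1 + (x : ℂ) * I) ^ (a - 1) * h3
  have hc : G v = G 0 := is_const_of_deriv_eq_zero (fun x => (hd x).differentiableAt)
    (fun x => (hd x).deriv) v 0
  have hne : (1 + (v : ℂ) * I) ^ a ≠ 0 := by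
    rw [Ne, cpow_eq_zero_iff]
    exact fun h => one_add_mul_I_ne_zero v h.1
  have h0 : G 0 = Gamma a := by
    have := integral_cpow_mul_exp_neg (s := a) ha one_pos
    simpa [hG] using! this
  rw [h0, hG] at hc
  rw [cpow_neg, ← hc]
  field_simp

lemma fourier_gammaKernel {a : ℂ} (ha : 0 < a.re) (w : ℝ) :
    𝓕 (gammaKernel a) w = Gamma a * (1 + ((2 * π * w : ℝ) : ℂ) * I) ^ (-a) := by
  rw [← integral_cpow_mul_exp_neg_one_add_mul_I ha, Real.fourier_real_eq_integral_exp_smul,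
    ← integral_indicator measurableSet_Ioi]
  congr 1
  ext t
  by_cases ht : t ∈ Ioi (0 : ℝ)
  · rw [gammaKernel, indicator_of_mem ht, indicator_of_mem ht, smul_eq_mul, mul_left_comm,
      ← Complex.exp_add]
    congr 2
    push_cast
    ring
  · rw [gammaKernel, indicator_of_notMem ht, indicator_of_notMem ht, smul_zero]

lemma integrable_one_add_mul_I_cpow {a : ℂ} (ha : 1 < a.re) :
    Integrable fun ξ : ℝ => (1 + (ξ : ℂ) * I) ^ (-a) := by
  refine (integrable_whittakerFourierIntegrand (a := 0) (b := a) (by simpa using ha) 0).congr ?_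
  exact Eventually.of_forall fun ξ => by simp [whittakerFourierIntegrand]

lemma integrable_one_sub_mul_I_cpow {a : ℂ} (ha : 1 < a.re) :
    Integrable fun ξ : ℝ => (1 - (ξ : ℂ) * I) ^ (-a) := by
  refine (integrable_whittakerFourierIntegrand (a := a) (b := 0) (by simpa using ha) 0).congr ?_
  exact Eventually.of_forall fun ξ => by simp [whittakerFourierIntegrand]

/-- Hankel's integral for the reciprocal Gamma function. -/
lemma integral_exp_mul_one_sub_mul_I_cpow {a : ℂ} (ha : 1 < a.re) {s : ℝ} (hs : 0 < s) :
    ∫ w : ℝ, cexp (((-2 * π * w * s : ℝ) : ℂ) * I) * (1 - ((2 * π * w : ℝ) : ℂ) * I) ^ (-a) =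
      (s : ℂ) ^ (a - 1) * cexp (-s) / Gamma a := by
  have ha0 : 0 < a.re := by linarith
  have hG : Gamma a ≠ 0 := Gamma_ne_zero_of_re_pos ha0
  have hF : Integrable (𝓕 (gammaKernel a)) := by
    have : 𝓕 (gammaKernel a) = fun w : ℝ => Gamma a * (1 + ((2 * π * w : ℝ) : ℂ) * I) ^ (-a) :=
      funext fun w => fourier_gammaKernel ha0 w
    rw [this]
    exact ((integrable_one_add_mul_I_cpow ha).comp_mul_left' (R := 2 * π)
      (by positivity)).const_mul _
  have hc : ContinuousAt (gammaKernel a) s := by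
    have : ContinuousAt (fun t : ℝ => (t : ℂ) ^ (a - 1) * cexp (-t)) s :=
      (continuousAt_ofReal_cpow_const s (a - 1) (Or.inr hs.ne')).mul (by fun_prop)
    refine this.congr ?_
    filter_upwards [Ioi_mem_nhds hs] with t ht
    rw [gammaKernel, indicator_of_mem ht]
  have := (integrable_gammaKernel ha0).fourier_fourierInv_eq hF hc
  rw [Real.fourier_real_eq_integral_exp_smul] at this
  have hv : gammaKernel a s = (s : ℂ) ^ (a - 1) * cexp (-s) := indicator_of_mem (mem_Ioi.2 hs) _
  rw [← hv]
  rw [← this, eq_div_iff hG, ← integral_mul_const]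
  congr 1
  ext w
  rw [Real.fourierInv_eq_fourier_neg, fourier_gammaKernel ha0, smul_eq_mul]
  push_cast
  ring_nf

lemma integral_Ioi_mul_shift {a b : ℂ} {x : ℝ} (hx : 0 < x) :
    ∫ s in Ioi (0 : ℝ), ((s : ℂ) ^ (b - 1) * cexp (-s)) *
      (((s + x : ℝ) : ℂ) ^ (a - 1) * cexp (-((s + x : ℝ) : ℂ))) =
      (x : ℂ) ^ (a + b - 1) * cexp (-x) * tricomiIntegral a b (2 * x) := by
  have hx' : (x : ℂ) ≠ 0 := ofReal_ne_zero.2 hx.ne'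
  have h := integral_comp_mul_left_Ioi (fun s : ℝ => ((s : ℂ) ^ (b - 1) * cexp (-s)) *
      (((s + x : ℝ) : ℂ) ^ (a - 1) * cexp (-((s + x : ℝ) : ℂ)))) 0 hx
  rw [mul_zero, real_smul, ofReal_inv, eq_inv_mul_iff_mul_eq₀ hx'] at h
  rw [← h, tricomiIntegral, ← integral_const_mul, ← integral_const_mul]
  refine setIntegral_congr_fun measurableSet_Ioi fun u hu => ?_
  have hu : 0 < u := hu
  simp only [tricomiIntegrand]
  have e1 : ((x * u + x : ℝ) : ℂ) ^ (a - 1) = (x : ℂ) ^ (a - 1) * (1 + (u : ℂ)) ^ (a - 1) := by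
    rw [show x * u + x = x * (1 + u) by ring, ofReal_mul,
      mul_cpow_ofReal_nonneg hx.le (by linarith)]
    push_cast
    rfl
  have e2 : ((x * u : ℝ) : ℂ) ^ (b - 1) = (x : ℂ) ^ (b - 1) * (u : ℂ) ^ (b - 1) := by
    rw [ofReal_mul, mul_cpow_ofReal_nonneg hx.le hu.le]
  have e3 : (x : ℂ) ^ (a + b - 1) = x * (x : ℂ) ^ (a - 1) * (x : ℂ) ^ (b - 1) := by
    rw [show a + b - 1 = 1 + (a - 1) + (b - 1) by ring, cpow_add _ _ hx', cpow_add _ _ hx',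
      cpow_one]
  have e4 : cexp (-((x * u : ℝ) : ℂ)) * cexp (-((x * u + x : ℝ) : ℂ)) =
      cexp (-x) * cexp (-(((2 * x : ℝ) : ℂ) * u)) := by
    rw [← Complex.exp_add, ← Complex.exp_add]
    congr 1
    push_cast
    ring
  rw [e1, e2, e3]
  linear_combination (x : ℂ) * ((x : ℂ) ^ (b - 1) * (u : ℂ) ^ (b - 1)) *
    ((x : ℂ) ^ (a - 1) * (1 + (u : ℂ)) ^ (a - 1)) * e4

lemma whittakerFourier_eq_of_one_lt_re {a b : ℂ} (ha : 1 < a.re) (hb : 0 < b.re) {x : ℝ}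
    (hx : 0 < x) :
    whittakerFourier a b (2 * x) = 2 * π * ((x : ℂ) ^ (a + b - 1) * cexp (-x) *
      tricomiIntegral a b (2 * x)) / (Gamma a * Gamma b) := by
  have hGa : Gamma a ≠ 0 := Gamma_ne_zero_of_re_pos (by linarith)
  have hGb : Gamma b ≠ 0 := Gamma_ne_zero_of_re_pos hb
  set g : ℝ → ℂ := fun w =>
    cexp (((-2 * π * w * x : ℝ) : ℂ) * I) * (1 - ((2 * π * w : ℝ) : ℂ) * I) ^ (-a) with hg
  have hgi : Integrable g := by
    refine ((integrable_one_sub_mul_I_cpow ha).comp_mul_left' (R := 2 * π)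
      (by positivity)).bdd_mul (c := 1) (by fun_prop) (Eventually.of_forall fun w => ?_)
    rw [norm_exp_ofReal_mul_I]
  have hP : ∫ w, 𝓕 (gammaKernel b) w • g w = ∫ s, gammaKernel b s • 𝓕 g s := by
    simpa using! VectorFourier.integral_fourierIntegral_smul_eq_flip (L := innerₗ ℝ)
      Real.continuous_fourierChar continuous_inner (integrable_gammaKernel hb) hgi
  have hL : ∫ w, 𝓕 (gammaKernel b) w • g w =
      Gamma b * ((2 * (π : ℂ))⁻¹ * whittakerFourier a b (2 * x)) := by
    have h := Measure.integral_comp_mul_left (whittakerFourierIntegrand a b (2 * x)) (2 * π)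
    rw [abs_of_pos (by positivity), real_smul] at h
    have h2 : whittakerFourier a b (2 * x) = ∫ ξ : ℝ, whittakerFourierIntegrand a b (2 * x) ξ :=
      rfl
    push_cast at h
    rw [h2, ← h, ← integral_const_mul]
    congr 1
    ext w
    rw [fourier_gammaKernel hb, smul_eq_mul, hg, whittakerFourierIntegrand]
    have : -I * ((2 * x : ℝ) : ℂ) * ((2 * π * w : ℝ) : ℂ) / 2 =
        ((-2 * π * w * x : ℝ) : ℂ) * I := by
      push_cast; ring
    rw [this]
    ring
  have hR : ∫ s, gammaKernel b s • 𝓕 g s =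
      ((x : ℂ) ^ (a + b - 1) * cexp (-x) * tricomiIntegral a b (2 * x)) / Gamma a := by
    rw [← integral_Ioi_mul_shift hx, ← integral_div, ← integral_indicator measurableSet_Ioi]
    congr 1
    ext s
    by_cases hs : s ∈ Ioi (0 : ℝ)
    · have hs0 : 0 < s := hs
      rw [gammaKernel, indicator_of_mem hs, indicator_of_mem hs, smul_eq_mul, mul_div_assoc,
        ← integral_exp_mul_one_sub_mul_I_cpow ha (by linarith : 0 < s + x),
        Real.fourier_real_eq_integral_exp_smul]
      congr 2
      ext w
      rw [hg, smul_eq_mul, ← mul_assoc, ← Complex.exp_add]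
      congr 2
      push_cast
      ring
    · rw [gammaKernel, indicator_of_notMem hs, indicator_of_notMem hs, zero_smul]
  rw [hL, hR] at hP
  have hpi : (π : ℂ) ≠ 0 := ofReal_ne_zero.2 Real.pi_ne_zero
  field_simp at hP ⊢
  linear_combination hP

end FourierInversion

/-- The value of the Fourier integral `whittakerFourier a b (2 * x)` in terms of Tricomi's
integral. -/
noncomputable def tricomiFourier (a b : ℂ) (x : ℝ) : ℂ :=
  2 * Real.pi * ((x : ℂ) ^ (a + b - 1) * cexp (-x) * tricomiIntegral a b (2 * x)) *
    (Gamma a)⁻¹ * (Gamma b)⁻¹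

lemma tricomiFourier_add {a b : ℂ} (hb : 0 < b.re) {x : ℝ} (hx : 0 < x) :
    tricomiFourier (a + 1) b x + tricomiFourier a (b + 1) x =
      2 * tricomiFourier (a + 1) (b + 1) x := by
  have hx' : (x : ℂ) ≠ 0 := ofReal_ne_zero.2 hx.ne'
  have h := tricomiIntegral_contiguous (a := a) (b := b + 1) (y := 2 * x)
    (by simpa using hb) (by positivity)
  have e1 : (x : ℂ) ^ (a + 1 + (b + 1) - 1) = (x : ℂ) ^ (a + b) * x := by
    rw [show a + 1 + (b + 1) - 1 = a + b + 1 by ring, cpow_add _ _ hx', cpow_one]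
  simp only [tricomiFourier]
  rw [e1, show a + 1 + b - 1 = a + b by ring, show a + (b + 1) - 1 = a + b by ring,
    one_div_Gamma_eq_self_mul_one_div_Gamma_add_one a,
    one_div_Gamma_eq_self_mul_one_div_Gamma_add_one b]
  rw [add_sub_cancel_right] at h
  push_cast at h
  linear_combination 2 * Real.pi * (x : ℂ) ^ (a + b) * cexp (-x) *
    (Gamma (a + 1))⁻¹ * (Gamma (b + 1))⁻¹ * h

lemma mul_tricomiFourier {a b : ℂ} (hb : 0 < b.re) {x : ℝ} (hx : 0 < x) :
    x * tricomiFourier a b x =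
      a * tricomiFourier (a + 1) b x - b * tricomiFourier a (b + 1) x := by
  have hx' : (x : ℂ) ≠ 0 := ofReal_ne_zero.2 hx.ne'
  have h := tricomiIntegral_add_succ (a := a) (b := b) (y := 2 * x) hb (by positivity)
  have e1 : (x : ℂ) ^ (a + b) = (x : ℂ) ^ (a + b - 1) * x := by
    nth_rw 1 [show a + b = a + b - 1 + 1 by ring]
    rw [cpow_add _ _ hx', cpow_one]
  simp only [tricomiFourier]
  rw [show a + 1 + b - 1 = a + b by ring, show a + (b + 1) - 1 = a + b by ring, e1,
    one_div_Gamma_eq_self_mul_one_div_Gamma_add_one a,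
    one_div_Gamma_eq_self_mul_one_div_Gamma_add_one b]
  linear_combination 2 * Real.pi * (x : ℂ) ^ (a + b - 1) * x * cexp (-x) * a * b *
    (Gamma (a + 1))⁻¹ * (Gamma (b + 1))⁻¹ * h

lemma whittakerFourier_eq_of_nat_lt_re (k : ℕ) {a b : ℂ} (ha : 1 - k < a.re) (hb : k < b.re)
    {x : ℝ} (hx : 0 < x) : whittakerFourier a b (2 * x) = tricomiFourier a b x := by
  induction k generalizing a b with
  | zero =>
    rw [whittakerFourier_eq_of_one_lt_re (by simpa using ha) (by simpa using hb) hx,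
      tricomiFourier]
    field_simp
  | succ k ih =>
    push_cast at ha hb
    have h1 := ih (a := a + 1) (b := b) (by simp; linarith) (by linarith)
    have h2 := ih (a := a + 1) (b := b - 1) (by simp; linarith) (by simp; linarith)
    have h3 := whittakerFourier_pred_add_pred (a := a + 1) (b := b)
      (by simp; linarith) (2 * x)
    have hk : (0 : ℝ) ≤ k := k.cast_nonneg
    have h4 := tricomiFourier_add (a := a) (b := b - 1) (by simp; linarith) hx
    rw [sub_add_cancel] at h4
    rw [add_sub_cancel_right, h1, h2] at h3
    linear_combination h3 - h4

lemma whittakerFourier_eq {a b : ℂ} (hab : 1 < (a + b).re) (hb : 0 < b.re) {x : ℝ}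
    (hx : 0 < x) : whittakerFourier a b (2 * x) = tricomiFourier a b x := by
  have key : ∀ a b : ℂ, 2 < (a + b).re → 0 < b.re →
      whittakerFourier a b (2 * x) = tricomiFourier a b x := by
    intro a b hab hb
    have hc : 0 < ⌈b.re⌉₊ := Nat.ceil_pos.2 hb
    have hcast : ((⌈b.re⌉₊ - 1 : ℕ) : ℝ) = ⌈b.re⌉₊ - 1 := Nat.cast_pred hc
    have h1 := Nat.le_ceil b.re
    have h2 := Nat.ceil_lt_add_one hb.le
    rw [add_re] at hab
    exact whittakerFourier_eq_of_nat_lt_re (⌈b.re⌉₊ - 1) (by linarith) (by linarith) hx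
  have hx' : (x : ℂ) ≠ 0 := ofReal_ne_zero.2 hx.ne'
  have h := whittakerFourier_contiguous hab (2 * x)
  rw [add_re] at hab
  rw [key (a + 1) b (by simp; linarith) hb, key a (b + 1) (by simp; linarith) (by simp; linarith),
    ← mul_tricomiFourier hb hx] at h
  push_cast at h
  refine mul_left_cancel₀ hx' ?_
  linear_combination h

lemma log_sub_I (ξ : ℝ) : log ((ξ : ℂ) - I) = log (1 + ξ * I) - Real.pi / 2 * I := by
  have h : |arg (1 + (ξ : ℂ) * I)| < Real.pi / 2 := abs_arg_lt_pi_div_two_iff.2 (Or.inl (by simp))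
  rw [abs_lt] at h
  have him : (log (1 + ξ * I) - Real.pi / 2 * I).im = arg (1 + (ξ : ℂ) * I) - Real.pi / 2 := by
    simp [log_im]
  have hpi := Real.pi_pos
  rw [← log_exp (x := log (1 + ξ * I) - Real.pi / 2 * I) (by rw [him]; linarith)
    (by rw [him]; linarith), Complex.exp_sub, exp_log (one_add_mul_I_ne_zero ξ),
    exp_pi_div_two_mul_I, div_I]
  congr 1
  linear_combination (ξ : ℂ) * I_sq

lemma log_add_I (ξ : ℝ) : log ((ξ : ℂ) + I) = log (1 - ξ * I) + Real.pi / 2 * I := by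
  have h : |arg (1 - (ξ : ℂ) * I)| < Real.pi / 2 := abs_arg_lt_pi_div_two_iff.2 (Or.inl (by simp))
  rw [abs_lt] at h
  have him : (log (1 - ξ * I) + Real.pi / 2 * I).im = arg (1 - (ξ : ℂ) * I) + Real.pi / 2 := by
    simp [log_im]
  have hpi := Real.pi_pos
  rw [← log_exp (x := log (1 - ξ * I) + Real.pi / 2 * I) (by rw [him]; linarith)
    (by rw [him]; linarith), Complex.exp_add, exp_log (one_sub_mul_I_ne_zero ξ),
    exp_pi_div_two_mul_I]
  congr 1
  linear_combination (ξ : ℂ) * I_sq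

lemma log_sq_add_one (ξ : ℝ) :
    log ((ξ ^ 2 + 1 : ℝ) : ℂ) = log (1 + ξ * I) + log (1 - ξ * I) := by
  have h1 : |arg (1 - (ξ : ℂ) * I)| < Real.pi / 2 := abs_arg_lt_pi_div_two_iff.2 (Or.inl (by simp))
  have h2 : |arg (1 + (ξ : ℂ) * I)| < Real.pi / 2 := abs_arg_lt_pi_div_two_iff.2 (Or.inl (by simp))
  rw [abs_lt] at h1 h2
  rw [← log_exp (x := log (1 + ξ * I) + log (1 - ξ * I))
    (by rw [add_im, log_im, log_im]; linarith) (by rw [add_im, log_im, log_im]; linarith),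
    Complex.exp_add, exp_log (one_add_mul_I_ne_zero ξ), exp_log (one_sub_mul_I_ne_zero ξ)]
  congr 1
  push_cast
  linear_combination (ξ : ℂ) ^ 2 * I_sq

lemma whittaker_integrand_eq (μ ν : ℂ) (y ξ : ℝ) :
    cexp (-I * (y : ℂ) * (ξ : ℂ) / 2) * ((ξ ^ 2 + 1 : ℝ) : ℂ) ^ (-ν - 1 / 2) *
        cexp (μ * (log ((ξ : ℂ) - I) - log ((ξ : ℂ) + I))) =
      cexp (-(I * (Real.pi : ℂ) * μ)) *
        whittakerFourierIntegrand (μ + ν + 1 / 2) (ν + 1 / 2 - μ) y ξ := by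
  have h : ((ξ ^ 2 + 1 : ℝ) : ℂ) ≠ 0 := ofReal_ne_zero.2 (by positivity)
  rw [whittakerFourierIntegrand, cpow_def_of_ne_zero h,
    cpow_def_of_ne_zero (one_add_mul_I_ne_zero ξ), cpow_def_of_ne_zero (one_sub_mul_I_ne_zero ξ),
    log_sq_add_one, log_sub_I, log_add_I]
  simp only [← Complex.exp_add]
  congr 1
  ring

lemma Wh_eq_whittakerFourier (μ ν : ℂ) (y : ℝ) :
    Wh μ ν y = Gamma (μ + ν + 1 / 2) / (Real.pi : ℂ) * ((y / 4 : ℝ) : ℂ) ^ ((1 : ℂ) / 2 - ν) *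
      whittakerFourier (μ + ν + 1 / 2) (ν + 1 / 2 - μ) y := by
  have h : cexp (I * (Real.pi : ℂ) * μ) * cexp (-(I * (Real.pi : ℂ) * μ)) = 1 := by
    rw [← Complex.exp_add, add_neg_cancel, Complex.exp_zero]
  rw [Wh, whittakerFourier]
  simp_rw [whittaker_integrand_eq]
  rw [integral_const_mul]
  linear_combination Gamma (μ + ν + 1 / 2) / (Real.pi : ℂ) *
    ((y / 4 : ℝ) : ℂ) ^ ((1 : ℂ) / 2 - ν) *
    (∫ ξ, whittakerFourierIntegrand (μ + ν + 1 / 2) (ν + 1 / 2 - μ) y ξ) * h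

lemma norm_tricomiIntegral_le_of_one_le {a b : ℂ} (hb : 0 < b.re) {y : ℝ} (hy : 1 ≤ y) :
    ‖tricomiIntegral a b y‖ ≤ ∫ u in Ioi (0 : ℝ), ‖tricomiIntegrand a b 1 u‖ := by
  refine norm_integral_le_of_norm_le (integrableOn_tricomiIntegrand hb one_pos).norm
    ((ae_restrict_mem measurableSet_Ioi).mono fun u hu => ?_)
  have hu : 0 < u := hu
  rw [norm_tricomiIntegrand _ _ _ hu, norm_tricomiIntegrand _ _ _ hu]
  gcongr

lemma superpolynomialDecay_exp_mul_tricomiIntegral {a b : ℂ} (hb : 0 < b.re) :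
    SuperpolynomialDecay atTop (fun y : ℝ => (y : ℂ))
      (fun y => cexp (-y / 2) * tricomiIntegral a b y) := by
  intro n
  rw [tendsto_zero_iff_norm_tendsto_zero]
  have h := ((isLittleO_pow_exp_pos_mul_atTop n (half_pos one_pos)).tendsto_div_nhds_zero).mul_const
    (∫ u in Ioi (0 : ℝ), ‖tricomiIntegrand a b 1 u‖)
  rw [zero_mul] at h
  refine squeeze_zero' (Eventually.of_forall fun y => norm_nonneg _) ?_ h
  filter_upwards [eventually_ge_atTop 1] with y hy
  have hexp : ‖cexp (-(y : ℂ) / 2)‖ = (Real.exp (1 / 2 * y))⁻¹ := by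
    rw [Complex.norm_exp, ← Real.exp_neg]
    congr 1
    simp
    ring
  rw [norm_mul, norm_mul, norm_pow, norm_real, Real.norm_of_nonneg (by linarith : (0 : ℝ) ≤ y),
    hexp, ← mul_assoc, ← div_eq_mul_inv]
  gcongr
  exact norm_tricomiIntegral_le_of_one_le hb hy

/-- The functions `f` and `h` satisfy the differential relations and have the boundary behaviour
of `y ↦ y^{-ν-1/2} W_{μ,ν}(y)` and `y ↦ y^{-ν-1/2} W_{μ+1,ν}(y)`, and represent the corresponding
Fourier integrals. -/
structure IsReducedWhittakerPair (ν μ : ℂ) (f h : ℝ → ℂ) : Prop where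
  hasDerivAt_left : ∀ y : ℝ, 0 < y →
    HasDerivAt f (((y / 2 - (μ + ν + 1 / 2)) * f y - h y) / y) y
  hasDerivAt_right : ∀ y : ℝ, 0 < y →
    HasDerivAt h (((-(ν - 1 / 2 - μ) - y / 2) * h y -
      (μ + ν + 1 / 2) * (ν - 1 / 2 - μ) * f y) / y) y
  tendsto_left : Tendsto
    (fun y : ℝ => f y - Gamma (2 * ν) * (Gamma (ν + 1 / 2 - μ))⁻¹ * (y : ℂ) ^ (-(2 * ν)))
    (𝓝[>] 0) (𝓝 (Gamma (-(2 * ν)) * (Gamma (1 - (μ + ν + 1 / 2)))⁻¹))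
  tendsto_right : Tendsto
    (fun y : ℝ => h y - (ν - 1 / 2 - μ) * (Gamma (2 * ν) * (Gamma (ν + 1 / 2 - μ))⁻¹) *
      (y : ℂ) ^ (-(2 * ν)))
    (𝓝[>] 0)
    (𝓝 (-(μ + ν + 1 / 2) * (Gamma (-(2 * ν)) * (Gamma (1 - (μ + ν + 1 / 2)))⁻¹)))
  decay_left : SuperpolynomialDecay atTop (fun y : ℝ => (y : ℂ)) f
  decay_right : SuperpolynomialDecay atTop (fun y : ℝ => (y : ℂ)) h
  fourier_left : ∀ y : ℝ, 0 < y →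
    ((y / 4 : ℝ) : ℂ) ^ ((1 : ℂ) / 2 - ν) * whittakerFourier (μ + ν + 1 / 2) (ν + 1 / 2 - μ) y =
      Real.pi * (y : ℂ) ^ (1 / 2 + ν) * (f y * (Gamma (μ + ν + 1 / 2))⁻¹)
  fourier_right : ∀ y : ℝ, 0 < y →
    ((y / 4 : ℝ) : ℂ) ^ ((1 : ℂ) / 2 - ν) *
        whittakerFourier (μ + ν + 1 / 2 + 1) (ν + 1 / 2 - μ - 1) y =
      Real.pi * (y : ℂ) ^ (1 / 2 + ν) * (h y * (Gamma (μ + ν + 1 / 2 + 1))⁻¹)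

lemma tendsto_ofReal_cpow_nhdsGT_zero {s : ℂ} (hs : 0 < s.re) :
    Tendsto (fun y : ℝ => (y : ℂ) ^ s) (𝓝[>] 0) (𝓝 0) := by
  have h := (continuousAt_ofReal_cpow_const 0 s (Or.inl hs)).tendsto
  rw [ofReal_zero, zero_cpow (by rintro rfl; simp at hs)] at h
  exact h.mono_left nhdsWithin_le_nhds

lemma tendsto_ofReal_mul_cpow_nhdsGT_zero {s : ℂ} (hs : s.re < 1) :
    Tendsto (fun y : ℝ => (y : ℂ) * (y : ℂ) ^ (-s)) (𝓝[>] 0) (𝓝 0) := by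
  refine (tendsto_ofReal_cpow_nhdsGT_zero (s := 1 - s) (by simp; linarith)).congr' ?_
  filter_upwards [self_mem_nhdsWithin] with y hy
  have hy : 0 < y := hy
  rw [sub_eq_add_neg, cpow_add _ _ (ofReal_ne_zero.2 hy.ne'), cpow_one]

lemma tendsto_ofReal_nhdsGT_zero : Tendsto (fun y : ℝ => (y : ℂ)) (𝓝[>] 0) (𝓝 0) :=
  (continuous_ofReal.tendsto' 0 0 ofReal_zero).mono_left nhdsWithin_le_nhds

lemma tendsto_exp_mul_sub {g : ℝ → ℂ} {s A B : ℂ} (hs : s.re < 1)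
    (hg : Tendsto (fun y : ℝ => g y - B * (y : ℂ) ^ (-s)) (𝓝[>] 0) (𝓝 A)) :
    Tendsto (fun y : ℝ => cexp (-y / 2) * g y - B * (y : ℂ) ^ (-s)) (𝓝[>] 0) (𝓝 A) := by
  have hd : HasDerivAt (fun y : ℝ => cexp (-y / 2)) (cexp (-(0 : ℝ) / 2) * (-1 / 2)) 0 :=
    ((hasDerivAt_id ((0 : ℝ) : ℂ)).neg.div_const 2).cexp.comp_ofReal
  have h1 := hd.tendsto_slope.mono_left (nhdsGT_le_nhdsNE (0 : ℝ))
  have h2 := (h1.mul (tendsto_ofReal_mul_cpow_nhdsGT_zero hs)).const_mul B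
  have h3 : Tendsto (fun y : ℝ => cexp (-y / 2)) (𝓝[>] 0) (𝓝 1) := by
    have := hd.continuousAt.tendsto.mono_left (nhdsWithin_le_nhds (s := Ioi 0))
    simpa using this
  have h4 := (h3.mul hg).add h2
  rw [mul_zero, mul_zero, add_zero, one_mul] at h4
  refine h4.congr' ?_
  filter_upwards [self_mem_nhdsWithin] with y hy
  have hy : (y : ℂ) ≠ 0 := ofReal_ne_zero.2 (ne_of_gt hy)
  simp only [slope, vsub_eq_sub, sub_zero, real_smul, ofReal_inv, ofReal_zero, neg_zero, zero_div,
    Complex.exp_zero]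
  field_simp
  ring

lemma tendsto_exp_mul_tricomiIntegral_sub {a b s : ℂ} (hb : 0 < b.re) (hs : a + b = 1 + s)
    (hs0 : 0 < s.re) (hs1 : s.re < 1) :
    Tendsto (fun y : ℝ => cexp (-y / 2) * tricomiIntegral a b y * (Gamma b)⁻¹ -
      Gamma s * (Gamma b)⁻¹ * (y : ℂ) ^ (-s)) (𝓝[>] 0)
      (𝓝 (Gamma (-s) * (Gamma (1 - a))⁻¹)) := by
  have h := (tendsto_exp_mul_sub hs1 (tendsto_tricomiIntegral_sub hb hs hs0 hs1)).mul_const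
    (Gamma b)⁻¹
  have hG := Gamma_ne_zero_of_re_pos hb
  rw [show Gamma b * Gamma (-s) / Gamma (1 - a) * (Gamma b)⁻¹ =
    Gamma (-s) * (Gamma (1 - a))⁻¹ by field_simp] at h
  refine h.congr fun y => ?_
  ring

lemma hasDerivAt_exp_mul_tricomiIntegral {a b : ℂ} {y : ℝ} (hb : 0 < b.re) (hy : 0 < y) :
    HasDerivAt (fun y : ℝ => cexp (-y / 2) * tricomiIntegral a b y)
      (-(cexp (-y / 2) * (tricomiIntegral a b y / 2 + tricomiIntegral a (b + 1) y))) y := by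
  have hd : HasDerivAt (fun y : ℝ => cexp (-y / 2)) (cexp (-y / 2) * (-1 / 2)) y :=
    ((hasDerivAt_id (y : ℂ)).neg.div_const 2).cexp.comp_ofReal
  refine (hd.mul (hasDerivAt_tricomiIntegral (a := a) hb hy)).congr_deriv ?_
  ring

lemma fourier_eq_exp_mul_tricomiIntegral {ν a b : ℂ} (hν : 0 < ν.re) (hb : 0 < b.re)
    (hab : a + b = 1 + 2 * ν) {y : ℝ} (hy : 0 < y) :
    ((y / 4 : ℝ) : ℂ) ^ ((1 : ℂ) / 2 - ν) * whittakerFourier a b y =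
      Real.pi * (y : ℂ) ^ (1 / 2 + ν) *
        (cexp (-y / 2) * tricomiIntegral a b y * (Gamma b)⁻¹ * (Gamma a)⁻¹) := by
  have hy' : (y : ℂ) ≠ 0 := ofReal_ne_zero.2 hy.ne'
  have h := whittakerFourier_eq (a := a) (b := b) (by rw [hab]; simpa using hν) hb (half_pos hy)
  rw [mul_div_cancel₀ y two_ne_zero, tricomiFourier, mul_div_cancel₀ y two_ne_zero, hab] at h
  have e1 : ((y / 4 : ℝ) : ℂ) ^ ((1 : ℂ) / 2 - ν) =
      (y : ℂ) ^ ((1 : ℂ) / 2 - ν) * (2 : ℂ) ^ (2 * ν - 1) := by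
    rw [show y / 4 = y * (1 / 4) by ring, ofReal_mul,
      mul_cpow_ofReal_nonneg hy.le (by norm_num)]
    congr 1
    have h2 : (((1 / 4 : ℝ)) : ℂ) = (2 : ℂ) ^ (-2 : ℂ) := by
      rw [cpow_neg, show (2 : ℂ) = ((2 : ℕ) : ℂ) by norm_num, cpow_natCast]
      norm_num
    have hl : (log 2).im = 0 := by
      rw [show (2 : ℂ) = ((2 : ℝ) : ℂ) by norm_num, log_im, arg_ofReal_of_nonneg (by norm_num)]
    rw [h2, ← cpow_mul]
    · congr 1; ring
    · simp [hl, Real.pi_pos]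
    · simp [hl, Real.pi_pos.le]
  have e2 : ((y / 2 : ℝ) : ℂ) ^ (1 + 2 * ν - 1) = (y : ℂ) ^ (2 * ν) * (2 : ℂ) ^ (-(2 * ν)) := by
    rw [show y / 2 = y * 2⁻¹ by ring, ofReal_mul, mul_cpow_ofReal_nonneg hy.le (by norm_num),
      add_sub_cancel_left]
    congr 1
    rw [ofReal_inv, ofReal_ofNat, inv_cpow, cpow_neg]
    rw [show (2 : ℂ) = ((2 : ℝ) : ℂ) by norm_num, arg_ofReal_of_nonneg (by norm_num)]
    exact Real.pi_pos.ne
  have e3 : (y : ℂ) ^ (1 / 2 + ν) = (y : ℂ) ^ ((1 : ℂ) / 2 - ν) * (y : ℂ) ^ (2 * ν) := by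
    rw [← cpow_add _ _ hy']
    congr 1
    ring
  have e4 : (2 : ℂ) ^ (2 * ν - 1) * (2 : ℂ) ^ (-(2 * ν)) = 1 / 2 := by
    rw [← cpow_add _ _ two_ne_zero, show 2 * ν - 1 + -(2 * ν) = -1 by ring, cpow_neg_one, one_div]
  rw [h, e1, e2, e3]
  have e5 : -((y / 2 : ℝ) : ℂ) = -y / 2 := by push_cast; ring
  rw [e5]
  linear_combination 2 * (Real.pi : ℂ) * (y : ℂ) ^ ((1 : ℂ) / 2 - ν) * (y : ℂ) ^ (2 * ν) *
    (cexp (-y / 2) * tricomiIntegral a b y * (Gamma b)⁻¹ * (Gamma a)⁻¹) * e4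

lemma isReducedWhittakerPair_of_re_lt {ν μ : ℂ} (hν0 : 0 < ν.re) (hν1 : ν.re < 1 / 2)
    (hμ : μ.re < ν.re - 1 / 2) :
    IsReducedWhittakerPair ν μ
      (fun y => cexp (-y / 2) * tricomiIntegral (μ + ν + 1 / 2) (ν + 1 / 2 - μ) y *
        (Gamma (ν + 1 / 2 - μ))⁻¹)
      (fun y => cexp (-y / 2) * tricomiIntegral (μ + ν + 1 / 2 + 1) (ν - 1 / 2 - μ) y *
        (Gamma (ν - 1 / 2 - μ))⁻¹) := by
  set a := μ + ν + 1 / 2 with ha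
  set b := ν + 1 / 2 - μ with hb
  have hb' : ν - 1 / 2 - μ = b - 1 := by rw [hb]; ring
  have hbre : 1 < b.re := by
    rw [hb]; norm_num; linarith
  have hb0 : 0 < b.re := by linarith
  have hb1 : 0 < (b - 1).re := by simpa using hbre
  have hab : a + b = 1 + 2 * ν := by rw [ha, hb]; ring
  have hG : (Gamma (b - 1))⁻¹ = (b - 1) * (Gamma b)⁻¹ := by
    rw [one_div_Gamma_eq_self_mul_one_div_Gamma_add_one, sub_add_cancel]
  have hGa : (Gamma (1 - (a + 1)))⁻¹ = -a * (Gamma (1 - a))⁻¹ := by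
    rw [one_div_Gamma_eq_self_mul_one_div_Gamma_add_one]
    congr 2
    · ring
    · congr 1; ring
  have hs0 : 0 < (2 * ν).re := by simpa using hν0
  have hs1 : (2 * ν).re < 1 := by
    norm_num; linarith
  have hc : ∀ y : ℝ, 0 < y → (b - 1) * tricomiIntegral (a + 1) (b - 1) y +
      a * tricomiIntegral a b y = y * tricomiIntegral (a + 1) b y :=
    fun y hy => tricomiIntegral_contiguous hbre hy
  rw [hb']
  refine ⟨fun y hy => ?_, fun y hy => ?_, ?_, ?_, ?_, ?_, fun y hy => ?_, fun y hy => ?_⟩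
  · have hy' : (y : ℂ) ≠ 0 := ofReal_ne_zero.2 hy.ne'
    refine ((hasDerivAt_exp_mul_tricomiIntegral hb0 hy).mul_const _).congr_deriv ?_
    rw [eq_div_iff hy', hG]
    linear_combination cexp (-y / 2) * (Gamma b)⁻¹ * (hc y hy -
      y * tricomiIntegral_add_succ (a := a) hb0 hy)
  · have hy' : (y : ℂ) ≠ 0 := ofReal_ne_zero.2 hy.ne'
    refine ((hasDerivAt_exp_mul_tricomiIntegral hb1 hy).mul_const _).congr_deriv ?_
    rw [eq_div_iff hy', hG, sub_add_cancel, hb']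
    linear_combination cexp (-y / 2) * (Gamma b)⁻¹ * (b - 1) * hc y hy
  · exact tendsto_exp_mul_tricomiIntegral_sub hb0 hab hs0 hs1
  · have := tendsto_exp_mul_tricomiIntegral_sub (a := a + 1) hb1 (s := 2 * ν)
      (by linear_combination hab) hs0 hs1
    rw [hGa, hG] at this
    rw [hb', hG]
    convert! this using 2
    · ring
    · ring
  · exact (superpolynomialDecay_exp_mul_tricomiIntegral hb0).mul_const _
  · exact (superpolynomialDecay_exp_mul_tricomiIntegral hb1).mul_const _
  · exact fourier_eq_exp_mul_tricomiIntegral hν0 hb0 hab hy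
  · exact fourier_eq_exp_mul_tricomiIntegral hν0 hb1 (by linear_combination hab) hy

lemma IsReducedWhittakerPair.succ {ν μ : ℂ} {f h : ℝ → ℂ} (hν0 : 0 < ν.re) (hν1 : ν.re < 1 / 2)
    (hμ : μ + ν + 1 / 2 + 1 ≠ 0) (H : IsReducedWhittakerPair ν μ f h) :
    IsReducedWhittakerPair ν (μ + 1) h
      (fun y => (y - (2 * μ + 2)) * h y + (μ + ν + 1 / 2) * (ν - 1 / 2 - μ) * f y) := by
  have hs1 : (2 * ν).re < 1 := by
    norm_num; linarith
  have hGb : (Gamma (ν + 1 / 2 - (μ + 1)))⁻¹ = (ν - 1 / 2 - μ) * (Gamma (ν + 1 / 2 - μ))⁻¹ := by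
    rw [one_div_Gamma_eq_self_mul_one_div_Gamma_add_one,
      show ν + 1 / 2 - (μ + 1) = ν - 1 / 2 - μ by ring,
      show ν - 1 / 2 - μ + 1 = ν + 1 / 2 - μ by ring]
  have hGa : (Gamma (1 - (μ + 1 + ν + 1 / 2)))⁻¹ =
      -(μ + ν + 1 / 2) * (Gamma (1 - (μ + ν + 1 / 2)))⁻¹ := by
    rw [one_div_Gamma_eq_self_mul_one_div_Gamma_add_one]
    congr 2
    · ring
    · congr 1; ring
  refine ⟨fun y hy => ?_, fun y hy => ?_, ?_, ?_, H.decay_right, ?_, fun y hy => ?_, fun y hy => ?_⟩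
  · refine (H.hasDerivAt_right y hy).congr_deriv ?_
    ring
  · have hy' : (y : ℂ) ≠ 0 := ofReal_ne_zero.2 hy.ne'
    have h1 : HasDerivAt (fun y : ℝ => (y : ℂ) - (2 * μ + 2)) 1 y :=
      ((hasDerivAt_id (y : ℂ)).sub_const _).comp_ofReal
    refine ((h1.mul (H.hasDerivAt_right y hy)).add
      ((H.hasDerivAt_left y hy).const_mul ((μ + ν + 1 / 2) * (ν - 1 / 2 - μ)))).congr_deriv ?_
    field_simp
    ring
  · convert! H.tendsto_right using 2
    · rw [hGb]; ring
    · rw [hGa]; ring_nf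
  · have h1 := ((tendsto_ofReal_nhdsGT_zero.sub_const (2 * μ + 2)).mul H.tendsto_right).add
      ((H.tendsto_left.const_mul ((μ + ν + 1 / 2) * (ν - 1 / 2 - μ))).add
      ((tendsto_ofReal_mul_cpow_nhdsGT_zero hs1).const_mul
        ((ν - 1 / 2 - μ) * (Gamma (2 * ν) * (Gamma (ν + 1 / 2 - μ))⁻¹))))
    convert! h1 using 2
    · rw [hGb]; ring
    · rw [hGa]; ring
  · have h1 := (H.decay_right.param_mul.add (H.decay_right.const_mul (-(2 * μ + 2)))).add
      (H.decay_left.const_mul ((μ + ν + 1 / 2) * (ν - 1 / 2 - μ)))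
    refine h1.congr fun y => ?_
    simp only [Pi.add_apply, Pi.mul_apply]
    ring
  · rw [show μ + 1 + ν + 1 / 2 = μ + ν + 1 / 2 + 1 by ring,
      show ν + 1 / 2 - (μ + 1) = ν + 1 / 2 - μ - 1 by ring]
    exact H.fourier_right y hy
  · rw [show μ + 1 + ν + 1 / 2 = μ + ν + 1 / 2 + 1 by ring,
      show ν + 1 / 2 - (μ + 1) = ν + 1 / 2 - μ - 1 by ring]
    have h1 := whittakerFourier_three_term (a := μ + ν + 1 / 2 + 1) (b := ν + 1 / 2 - μ - 1)
      (by norm_num; linarith) y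
    rw [add_sub_cancel_right, sub_add_cancel] at h1
    have h2 := H.fourier_left y hy
    have h3 := H.fourier_right y hy
    rw [one_div_Gamma_eq_self_mul_one_div_Gamma_add_one (μ + ν + 1 / 2),
      one_div_Gamma_eq_self_mul_one_div_Gamma_add_one (μ + ν + 1 / 2 + 1)] at h2
    rw [one_div_Gamma_eq_self_mul_one_div_Gamma_add_one (μ + ν + 1 / 2 + 1)] at h3
    refine mul_left_cancel₀ hμ ?_
    linear_combination ((y / 4 : ℝ) : ℂ) ^ ((1 : ℂ) / 2 - ν) * h1 +
      (y - (2 * μ + 2)) * h3 + (ν - 1 / 2 - μ) * h2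

lemma exists_isReducedWhittakerPair_add_nat {ν μ : ℂ} (hν0 : 0 < ν.re) (hν1 : ν.re < 1 / 2)
    (hμ0 : -(ν.re + 3 / 2) < μ.re) (hμ1 : μ.re < ν.re - 1 / 2) (n : ℕ) :
    ∃ f h, IsReducedWhittakerPair ν (μ + n) f h := by
  induction n with
  | zero => exact ⟨_, _, by simpa using! isReducedWhittakerPair_of_re_lt hν0 hν1 hμ1⟩
  | succ n ih =>
    obtain ⟨f, h, H⟩ := ih
    rw [Nat.cast_succ, ← add_assoc]
    refine ⟨_, _, H.succ hν0 hν1 fun h0 => ?_⟩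
    have h1 := congrArg re h0
    have hn : (0 : ℝ) ≤ n := n.cast_nonneg
    norm_num at h1
    linarith

lemma exists_isReducedWhittakerPair {ν : ℂ} (hν0 : 0 < ν.re) (hν1 : ν.re < 1 / 2) (μ : ℂ) :
    ∃ f h, IsReducedWhittakerPair ν μ f h := by
  rcases lt_or_ge μ.re (ν.re - 1 / 2) with hμ | hμ
  · exact ⟨_, _, isReducedWhittakerPair_of_re_lt hν0 hν1 hμ⟩
  · have h0 : 0 ≤ μ.re - (ν.re - 1 / 2) := by linarith
    have h1 := Nat.lt_floor_add_one (μ.re - (ν.re - 1 / 2))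
    have h2 := Nat.floor_le h0
    set n := ⌊μ.re - (ν.re - 1 / 2)⌋₊ with hn
    have := exists_isReducedWhittakerPair_add_nat (μ := μ - ((n + 1 : ℕ) : ℂ)) hν0 hν1
      (by rw [sub_re, natCast_re]; push_cast; linarith)
      (by rw [sub_re, natCast_re]; push_cast; linarith) (n + 1)
    rwa [sub_add_cancel] at this

lemma IsReducedWhittakerPair.Wh_eq {ν μ : ℂ} {f h : ℝ → ℂ} (H : IsReducedWhittakerPair ν μ f h)
    (hpole : ∀ n : ℕ, μ + ν + 1 / 2 ≠ -(n : ℂ)) {y : ℝ} (hy : 0 < y) :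
    Wh μ ν y = (y : ℂ) ^ (1 / 2 + ν) * f y := by
  have hG := Gamma_ne_zero hpole
  have hpi : (Real.pi : ℂ) ≠ 0 := ofReal_ne_zero.2 Real.pi_ne_zero
  rw [Wh_eq_whittakerFourier, mul_assoc, H.fourier_left y hy]
  linear_combination (y : ℂ) ^ (1 / 2 + ν) * f y *
    ((Real.pi : ℂ)⁻¹ * Real.pi * mul_inv_cancel₀ hG + inv_mul_cancel₀ hpi)

lemma tendsto_cpow_mul_mul_sub {f g : ℝ → ℂ} {s A B C D : ℂ} (hs : 0 < s.re)
    (hf : Tendsto (fun y : ℝ => f y - B * (y : ℂ) ^ (-s)) (𝓝[>] 0) (𝓝 A))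
    (hg : Tendsto (fun y : ℝ => g y - D * (y : ℂ) ^ (-s)) (𝓝[>] 0) (𝓝 C)) :
    Tendsto (fun y : ℝ => (y : ℂ) ^ s * (f y * g y) - B * D * (y : ℂ) ^ (-s)) (𝓝[>] 0)
      (𝓝 (A * D + B * C)) := by
  have h := (((tendsto_ofReal_cpow_nhdsGT_zero hs).mul (hf.mul hg)).add
    ((hf.mul_const D).add (hg.const_mul B)))
  rw [zero_mul, zero_add] at h
  refine h.congr' ?_
  filter_upwards [self_mem_nhdsWithin] with y hy
  have hy : (y : ℂ) ≠ 0 := ofReal_ne_zero.2 (ne_of_gt hy)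
  have e : (y : ℂ) ^ s * (y : ℂ) ^ (-s) = 1 := by
    rw [← cpow_add _ _ hy, add_neg_cancel, cpow_zero]
  linear_combination (-(f y * D + B * g y) + B * D * (y : ℂ) ^ (-s)) * e

lemma isBigO_cpow_mul_of_superpolynomialDecay {g : ℝ → ℂ} (s : ℂ)
    (hg : SuperpolynomialDecay atTop (fun y : ℝ => (y : ℂ)) g) (m : ℝ) :
    (fun y : ℝ => (y : ℂ) ^ s * g y) =O[atTop] fun y : ℝ => y ^ (-m) := by
  obtain ⟨n, hn⟩ := exists_nat_ge (s.re + m)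
  have h1 := (hg n).isBigO_one ℝ
  have h2 : (fun y : ℝ => (y : ℂ) ^ s * g y) =O[atTop]
      fun y : ℝ => y ^ (-m) * ‖(y : ℂ) ^ n * g y‖ := by
    refine IsBigO.of_bound 1 ?_
    filter_upwards [eventually_ge_atTop 1] with y hy
    have hy0 : 0 < y := by linarith
    rw [norm_mul, norm_cpow_eq_rpow_re_of_pos hy0, norm_mul, norm_norm, norm_mul, norm_pow,
      norm_real, Real.norm_of_nonneg hy0.le, Real.norm_of_nonneg (by positivity), one_mul,
      ← mul_assoc, ← Real.rpow_natCast, ← Real.rpow_add hy0]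
    gcongr
    linarith
  refine h2.trans ?_
  simpa using (isBigO_refl (fun y : ℝ => y ^ (-m)) atTop).mul h1.norm_left

lemma tendsto_cpow_mul_of_superpolynomialDecay {g : ℝ → ℂ} (s : ℂ)
    (hg : SuperpolynomialDecay atTop (fun y : ℝ => (y : ℂ)) g) :
    Tendsto (fun y : ℝ => (y : ℂ) ^ s * g y) atTop (𝓝 0) :=
  (isBigO_cpow_mul_of_superpolynomialDecay s hg 1).trans_tendsto
    (tendsto_rpow_neg_atTop one_pos)

lemma integrableOn_cpow_mul_mul {f g : ℝ → ℂ} {s A B C D : ℂ} (hs0 : 0 < s.re) (hs1 : s.re < 1)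
    (hfc : ContinuousOn f (Ioi 0)) (hgc : ContinuousOn g (Ioi 0))
    (hf : Tendsto (fun y : ℝ => f y - B * (y : ℂ) ^ (-s)) (𝓝[>] 0) (𝓝 A))
    (hg : Tendsto (fun y : ℝ => g y - D * (y : ℂ) ^ (-s)) (𝓝[>] 0) (𝓝 C))
    (hfd : SuperpolynomialDecay atTop (fun y : ℝ => (y : ℂ)) f)
    (hgd : SuperpolynomialDecay atTop (fun y : ℝ => (y : ℂ)) g) :
    IntegrableOn (fun y : ℝ => (y : ℂ) ^ s * (f y * g y)) (Ioi 0) := by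
  have hc : ContinuousOn (fun y : ℝ => (y : ℂ) ^ s * (f y * g y)) (Ioi 0) :=
    ContinuousOn.mul (fun y hy => (continuousAt_ofReal_cpow_const y s
      (Or.inr (ne_of_gt hy))).continuousWithinAt) (hfc.mul hgc)
  have hzero : (fun y : ℝ => (y : ℂ) ^ s * (f y * g y)) =O[𝓝[>] 0]
      fun y : ℝ => y ^ (-s.re) := by
    have h1 := (tendsto_cpow_mul_mul_sub hs0 hf hg).isBigO_one ℝ
    have h2 : (fun _ : ℝ => (1 : ℝ)) =O[𝓝[>] 0] fun y : ℝ => y ^ (-s.re) := by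
      refine IsBigO.of_bound 1 ?_
      filter_upwards [Ioo_mem_nhdsGT one_pos] with y hy
      rw [norm_one, one_mul, Real.norm_of_nonneg (Real.rpow_nonneg hy.1.le _)]
      exact Real.one_le_rpow_of_pos_of_le_one_of_nonpos hy.1 hy.2.le (by linarith)
    have h3 : (fun y : ℝ => B * D * (y : ℂ) ^ (-s)) =O[𝓝[>] 0] fun y : ℝ => y ^ (-s.re) := by
      refine IsBigO.of_bound ‖B * D‖ ?_
      filter_upwards [self_mem_nhdsWithin] with y hy
      have hy : 0 < y := hy
      rw [norm_mul, norm_cpow_eq_rpow_re_of_pos hy, neg_re,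
        Real.norm_of_nonneg (Real.rpow_nonneg hy.le _)]
    refine ((h1.trans h2).add h3).congr_left fun y => ?_
    ring
  have key : MellinConvergent (fun y : ℝ => (y : ℂ) ^ s * (f y * g y)) 1 :=
    mellinConvergent_of_isBigO_rpow (hc.locallyIntegrableOn measurableSet_Ioi)
      (isBigO_cpow_mul_of_superpolynomialDecay s (hfd.mul hgd) 2) (by norm_num) hzero
      (by simpa using hs1)
  refine key.congr_fun (fun y _ => ?_) measurableSet_Ioi
  simp

lemma two_mul_Gamma_mul_Gamma_neg {ν : ℂ} (hν : ν ≠ 0) :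
    2 * ν * (Gamma (2 * ν) * Gamma (-(2 * ν))) = -(Real.pi / sin (2 * Real.pi * ν)) := by
  have h := Gamma_mul_Gamma_one_sub (2 * ν)
  have h1 := Gamma_add_one (-(2 * ν)) (by simpa using hν)
  rw [show 1 - 2 * ν = -(2 * ν) + 1 by ring, h1,
    show (Real.pi : ℂ) * (2 * ν) = 2 * Real.pi * ν by ring] at h
  linear_combination -h

namespace IsReducedWhittakerPair

variable {ν μ α β : ℂ} {f h f₁ h₁ f₂ h₂ : ℝ → ℂ}

lemma continuousOn_left (H : IsReducedWhittakerPair ν μ f h) : ContinuousOn f (Ioi 0) :=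
  fun y hy => (H.hasDerivAt_left y hy).continuousAt.continuousWithinAt

lemma hasDerivAt_wronskian (H₁ : IsReducedWhittakerPair ν α f₁ h₁)
    (H₂ : IsReducedWhittakerPair ν β f₂ h₂) {y : ℝ} (hy : 0 < y) :
    HasDerivAt (fun y : ℝ => (y : ℂ) ^ (2 * ν) *
      (h₁ y * f₂ y - f₁ y * h₂ y + (α - β) * (f₁ y * f₂ y)))
      ((α - β) * ((y : ℂ) ^ (2 * ν) * (f₁ y * f₂ y))) y := by
  have hy' : (y : ℂ) ≠ 0 := ofReal_ne_zero.2 hy.ne'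
  have h0 : HasDerivAt (fun y : ℝ => (y : ℂ) ^ (2 * ν))
      (2 * ν * (y : ℂ) ^ (2 * ν - 1) * 1) y :=
    ((hasDerivAt_id (y : ℂ)).cpow_const (ofReal_mem_slitPlane.2 hy)).comp_ofReal
  have d1 := H₁.hasDerivAt_left y hy
  have d2 := H₂.hasDerivAt_left y hy
  have e1 := H₁.hasDerivAt_right y hy
  have e2 := H₂.hasDerivAt_right y hy
  refine (h0.mul (((e1.mul d2).sub (d1.mul e2)).add ((d1.mul d2).const_mul (α - β)))).congr_deriv ?_
  rw [cpow_sub _ _ hy', cpow_one]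
  simp only [Pi.mul_apply, Pi.sub_apply, Pi.add_apply]
  field_simp
  ring

lemma tendsto_wronskian_atTop (H₁ : IsReducedWhittakerPair ν α f₁ h₁)
    (H₂ : IsReducedWhittakerPair ν β f₂ h₂) :
    Tendsto (fun y : ℝ => (y : ℂ) ^ (2 * ν) *
      (h₁ y * f₂ y - f₁ y * h₂ y + (α - β) * (f₁ y * f₂ y))) atTop (𝓝 0) := by
  refine tendsto_cpow_mul_of_superpolynomialDecay _ ?_
  refine (((H₁.decay_right.mul H₂.decay_left).add
    ((H₁.decay_left.mul H₂.decay_right).const_mul (-1))).add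
    ((H₁.decay_left.mul H₂.decay_left).const_mul (α - β))).congr fun y => ?_
  simp only [Pi.add_apply, Pi.mul_apply]
  ring

lemma tendsto_wronskian_nhdsGT_zero (hν : 0 < ν.re) (H₁ : IsReducedWhittakerPair ν α f₁ h₁)
    (H₂ : IsReducedWhittakerPair ν β f₂ h₂) :
    Tendsto (fun y : ℝ => (y : ℂ) ^ (2 * ν) *
      (h₁ y * f₂ y - f₁ y * h₂ y + (α - β) * (f₁ y * f₂ y))) (𝓝[>] 0)
      (𝓝 (2 * ν * (Gamma (2 * ν) * Gamma (-(2 * ν))) *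
        ((Gamma (ν + 1 / 2 - α))⁻¹ * (Gamma (1 - (β + ν + 1 / 2)))⁻¹ -
          (Gamma (1 - (α + ν + 1 / 2)))⁻¹ * (Gamma (ν + 1 / 2 - β))⁻¹))) := by
  have hs : 0 < (2 * ν).re := by simpa using hν
  have t1 := tendsto_cpow_mul_mul_sub hs H₁.tendsto_right H₂.tendsto_left
  have t2 := tendsto_cpow_mul_mul_sub hs H₁.tendsto_left H₂.tendsto_right
  have t3 := tendsto_cpow_mul_mul_sub hs H₁.tendsto_left H₂.tendsto_left
  convert! (t1.sub t2).add (t3.const_mul (α - β)) using 2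
  · ring
  · ring

lemma integrableOn_cpow_mul (hν0 : 0 < ν.re) (hν1 : ν.re < 1 / 2)
    (H₁ : IsReducedWhittakerPair ν α f₁ h₁) (H₂ : IsReducedWhittakerPair ν β f₂ h₂) :
    IntegrableOn (fun y : ℝ => (y : ℂ) ^ (2 * ν) * (f₁ y * f₂ y)) (Ioi 0) :=
  integrableOn_cpow_mul_mul (by simpa using hν0) (by norm_num; linarith) H₁.continuousOn_left
    H₂.continuousOn_left H₁.tendsto_left H₂.tendsto_left H₁.decay_left H₂.decay_left

lemma sub_mul_integral (hν0 : 0 < ν.re) (hν1 : ν.re < 1 / 2)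
    (H₁ : IsReducedWhittakerPair ν α f₁ h₁) (H₂ : IsReducedWhittakerPair ν β f₂ h₂) :
    (α - β) * ∫ y in Ioi (0 : ℝ), (y : ℂ) ^ (2 * ν) * (f₁ y * f₂ y) =
      Real.pi / sin (2 * Real.pi * ν) *
        ((Gamma (ν + 1 / 2 - α))⁻¹ * (Gamma (1 - (β + ν + 1 / 2)))⁻¹ -
          (Gamma (1 - (α + ν + 1 / 2)))⁻¹ * (Gamma (ν + 1 / 2 - β))⁻¹) := by
  have hν : ν ≠ 0 := by rintro rfl; simp at hν0
  have hlim := tendsto_wronskian_nhdsGT_zero hν0 H₁ H₂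
  rw [two_mul_Gamma_mul_Gamma_neg hν] at hlim
  set T : ℝ → ℂ := fun y => (y : ℂ) ^ (2 * ν) *
    (h₁ y * f₂ y - f₁ y * h₂ y + (α - β) * (f₁ y * f₂ y)) with hT
  set L : ℂ := -(Real.pi / sin (2 * Real.pi * ν)) *
        ((Gamma (ν + 1 / 2 - α))⁻¹ * (Gamma (1 - (β + ν + 1 / 2)))⁻¹ -
          (Gamma (1 - (α + ν + 1 / 2)))⁻¹ * (Gamma (ν + 1 / 2 - β))⁻¹) with hL
  have hcont : ContinuousWithinAt (Function.update T 0 L) (Ici 0) 0 := by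
    rw [continuousWithinAt_update_same, Ici_sdiff_left]
    exact hlim
  have hderiv : ∀ y ∈ Ioi (0 : ℝ), HasDerivAt (Function.update T 0 L)
      ((α - β) * ((y : ℂ) ^ (2 * ν) * (f₁ y * f₂ y))) y := by
    intro y hy
    refine (hasDerivAt_wronskian H₁ H₂ hy).congr_of_eventuallyEq ?_
    filter_upwards [Ioi_mem_nhds hy] with x hx
    rw [Function.update_of_ne (ne_of_gt hx)]
  have htop : Tendsto (Function.update T 0 L) atTop (𝓝 0) := by
    refine (tendsto_wronskian_atTop H₁ H₂).congr' ?_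
    filter_upwards [Ioi_mem_atTop 0] with x hx
    rw [Function.update_of_ne (ne_of_gt hx)]
  have := integral_Ioi_of_hasDerivAt_of_tendsto hcont hderiv
    ((integrableOn_cpow_mul hν0 hν1 H₁ H₂).const_mul (α - β)) htop
  rw [integral_const_mul, Function.update_self] at this
  rw [this, hL]
  ring

end IsReducedWhittakerPair

end Whittaker

/-- Product integral formula for Whittaker functions. -/
theorem whittaker_product_integral (α β ν : ℂ) (hν0 : 0 < ν.re) (hν1 : ν.re < 1 / 2)
    (hαβ : α ≠ β) (hpoleα : ∀ n : ℕ, α + ν + 1 / 2 ≠ -(n : ℂ))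
    (hpoleβ : ∀ n : ℕ, β + ν + 1 / 2 ≠ -(n : ℂ)) :
    IntegrableOn (fun y : ℝ => Wh α ν y * Wh β ν y / (y : ℂ)) (Set.Ioi 0) ∧
    (∫ y in Set.Ioi (0 : ℝ), Wh α ν y * Wh β ν y / (y : ℂ)) =
      (Real.pi : ℂ) / ((α - β) * Complex.sin (2 * (Real.pi : ℂ) * ν)) *
        (1 / (Complex.Gamma (1 / 2 - α + ν) * Complex.Gamma (1 / 2 - β - ν)) -
          1 / (Complex.Gamma (1 / 2 - α - ν) * Complex.Gamma (1 / 2 - β + ν))) := by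
  obtain ⟨f₁, h₁, H₁⟩ := exists_isReducedWhittakerPair hν0 hν1 α
  obtain ⟨f₂, h₂, H₂⟩ := exists_isReducedWhittakerPair hν0 hν1 β
  have hW : Set.EqOn (fun y : ℝ => (y : ℂ) ^ (2 * ν) * (f₁ y * f₂ y))
      (fun y : ℝ => Wh α ν y * Wh β ν y / (y : ℂ)) (Set.Ioi 0) := by
    intro y hy
    have hy' : (y : ℂ) ≠ 0 := Complex.ofReal_ne_zero.2 (ne_of_gt hy)
    have hpow : (y : ℂ) ^ (1 / 2 + ν) * (y : ℂ) ^ (1 / 2 + ν) = (y : ℂ) ^ (2 * ν) * y := by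
      rw [← Complex.cpow_add _ _ hy', show (1 : ℂ) / 2 + ν + (1 / 2 + ν) = 2 * ν + 1 by ring,
        Complex.cpow_add _ _ hy', Complex.cpow_one]
    simp only []
    rw [eq_div_iff hy', H₁.Wh_eq hpoleα hy, H₂.Wh_eq hpoleβ hy]
    linear_combination -(f₁ y * f₂ y) * hpow
  refine ⟨(H₁.integrableOn_cpow_mul hν0 hν1 H₂).congr_fun hW measurableSet_Ioi, ?_⟩
  have h := H₁.sub_mul_integral hν0 hν1 H₂
  rw [setIntegral_congr_fun measurableSet_Ioi hW] at h
  have hαβ' : α - β ≠ 0 := sub_ne_zero.2 hαβ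
  refine mul_left_cancel₀ hαβ' (h.trans ?_)
  rw [show ν + 1 / 2 - α = 1 / 2 - α + ν by ring, show ν + 1 / 2 - β = 1 / 2 - β + ν by ring,
    show 1 - (α + ν + 1 / 2) = 1 / 2 - α - ν by ring,
    show 1 - (β + ν + 1 / 2) = 1 / 2 - β - ν by ring]
  generalize Complex.Gamma (1 / 2 - α + ν) = G₁
  generalize Complex.Gamma (1 / 2 - α - ν) = G₂
  generalize Complex.Gamma (1 / 2 - β + ν) = G₃
  generalize Complex.Gamma (1 / 2 - β - ν) = G₄
  simp only [div_eq_mul_inv, mul_inv, one_mul]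
  linear_combination (-(Real.pi : ℂ) * (Complex.sin (2 * Real.pi * ν))⁻¹ *
    (G₁⁻¹ * G₄⁻¹ - G₂⁻¹ * G₃⁻¹)) * mul_inv_cancel₀ hαβ'
end

section
/- Orthonormality of the Kirillov vectors in the unitary principal series: for every t ∈ ℝ (writing ν = it) and all ℓ, ℓ′ ∈ ℤ, (1/π) · ∫_{ℝ∖{0}} 𝒦_ℓ(u,it) · conj(𝒦_{ℓ′}(u,it)) · du/|u| = 1 if ℓ = ℓ′ and = 0 if ℓ ≠ ℓ′; the integral converges absolutely. -/
open MeasureTheory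

/-- The Kirillov vector 𝒦_ℓ(u,ν), the value at a[|u|] of the Jacquet transform 𝒜^{sgn u}
of the weight-2ℓ weight function on SL(2,ℝ). -/
noncomputable def Kvec (ℓ : ℤ) (ν : ℂ) (u : ℝ) : ℂ :=
  (Real.pi : ℂ) ^ ν / Complex.Gamma (ν + (ℓ.natAbs : ℂ) + 1 / 2) *
    ∑ j ∈ Finset.range (ℓ.natAbs + 1),
      (-(Real.pi : ℂ)) ^ j * ((2 * ℓ.natAbs).choose (2 * j) : ℂ) *
        Complex.Gamma ((ℓ.natAbs : ℂ) - (j : ℂ) + 1 / 2) * ((|u| : ℝ) : ℂ) ^ ((j : ℂ) + 1 / 2) *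
        ∫ t in Set.Ioi (0 : ℝ),
          (t : ℂ) ^ (ν - 1) *
            (((Real.sqrt t + Real.sign (u * (ℓ : ℝ)) / Real.sqrt t) ^ (2 * j) : ℝ) : ℂ) *
            (Real.exp (-(Real.pi * |u| * (t + 1 / t))) : ℂ)

open Complex in
lemma exists_pow_le_mul_exp_sq {r : ℝ} (hr : 0 < r) (k : ℕ) :
    ∃ C : ℝ, ∀ y : ℝ, 0 ≤ y → y ^ k ≤ C * Real.exp (r * y ^ 2) := by
  refine ⟨1 + k.factorial / r ^ k, fun y hy => ?_⟩
  have h1 : y ^ k ≤ 1 + (y ^ 2) ^ k := by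
    rw [← pow_mul, mul_comm, pow_mul]; nlinarith [sq_nonneg (y ^ k - 1), sq_nonneg (y ^ k)]
  have h2 := Real.pow_div_factorial_le_exp (x := r * y ^ 2) (by positivity) k
  have h3 : (1 : ℝ) ≤ Real.exp (r * y ^ 2) := Real.one_le_exp (by positivity)
  have h4 : (y ^ 2) ^ k ≤ k.factorial / r ^ k * Real.exp (r * y ^ 2) := by
    rw [div_mul_eq_mul_div, le_div_iff₀ (by positivity)]
    rw [div_le_iff₀ (by positivity), mul_pow] at h2
    linarith
  linarith

open Complex in
lemma integrable_shifted_pow_mul_gaussian {r : ℝ} (hr : 0 < r) (c : ℝ) (k : ℕ) :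
    Integrable fun x : ℝ => ((x : ℂ) + c * I) ^ k * cexp (-(r : ℂ) * ((x : ℂ) + c * I) ^ 2) := by
  obtain ⟨C, hC⟩ := exists_pow_le_mul_exp_sq (half_pos hr) k
  have hg : Integrable fun x : ℝ =>
      (C * Real.exp (3 / 2 * r * c ^ 2)) * Real.exp (-(r / 2) * x ^ 2) :=
    (integrable_exp_neg_mul_sq (half_pos hr)).const_mul _
  refine hg.mono' (by fun_prop) (Filter.Eventually.of_forall fun x => ?_)
  rw [norm_mul, norm_pow, norm_exp]
  have h1 : ‖(x : ℂ) + c * I‖ ^ 2 = x ^ 2 + c ^ 2 := by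
    rw [← Complex.normSq_eq_norm_sq, Complex.normSq_add_mul_I]
  have h2 : (-(r : ℂ) * ((x : ℂ) + c * I) ^ 2).re = -r * (x ^ 2 - c ^ 2) := by
    simp [pow_two]
  have h3 := hC _ (norm_nonneg ((x : ℂ) + c * I))
  rw [h1] at h3
  rw [h2]
  calc _ ≤ C * Real.exp (r / 2 * (x ^ 2 + c ^ 2)) * Real.exp (-r * (x ^ 2 - c ^ 2)) := by gcongr
    _ = _ := by
      rw [mul_assoc, mul_assoc, ← Real.exp_add, ← Real.exp_add]; congr 2; ring

open Complex in
lemma integral_shifted_pow_add_two {r : ℝ} (hr : 0 < r) (c : ℝ) (k : ℕ) :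
    2 * (r : ℂ) * ∫ x : ℝ, ((x : ℂ) + c * I) ^ (k + 2) * cexp (-(r : ℂ) * ((x : ℂ) + c * I) ^ 2) =
    (k + 1) * ∫ x : ℝ, ((x : ℂ) + c * I) ^ k * cexp (-(r : ℂ) * ((x : ℂ) + c * I) ^ 2) := by
  have hd : ∀ x : ℝ, HasDerivAt
      (fun x : ℝ => ((x : ℂ) + c * I) ^ (k + 1) * cexp (-(r : ℂ) * ((x : ℂ) + c * I) ^ 2))
      ((k + 1) * (((x : ℂ) + c * I) ^ k * cexp (-(r : ℂ) * ((x : ℂ) + c * I) ^ 2)) -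
        2 * (r : ℂ) * (((x : ℂ) + c * I) ^ (k + 2) * cexp (-(r : ℂ) * ((x : ℂ) + c * I) ^ 2)))
      x := by
    intro x
    have h0 : HasDerivAt (fun x : ℝ => (x : ℂ) + c * I) 1 x :=
      (ofRealCLM.hasDerivAt (x := x)).add_const _
    have h1 := h0.pow (k + 1)
    have h2 := ((h0.pow 2).const_mul (-(r : ℂ))).cexp
    refine (h1.mul h2).congr_deriv ?_
    simp
    ring
  have h := integral_eq_zero_of_hasDerivAt_of_integrable hd
    (((integrable_shifted_pow_mul_gaussian hr c k).const_mul _).sub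
      ((integrable_shifted_pow_mul_gaussian hr c (k + 2)).const_mul _))
    (integrable_shifted_pow_mul_gaussian hr c (k + 1))
  rw [integral_sub ((integrable_shifted_pow_mul_gaussian hr c k).const_mul _)
      ((integrable_shifted_pow_mul_gaussian hr c (k + 2)).const_mul _),
      integral_const_mul, integral_const_mul, sub_eq_zero] at h
  exact h.symm

open Complex in
lemma integral_shifted_pow_odd {r : ℝ} (hr : 0 < r) (c : ℝ) (m : ℕ) :
    ∫ x : ℝ, ((x : ℂ) + c * I) ^ (2 * m + 1) * cexp (-(r : ℂ) * ((x : ℂ) + c * I) ^ 2) = 0 := by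
  have hr' : (r : ℂ) ≠ 0 := by exact_mod_cast hr.ne'
  induction m with
  | zero =>
    have hd : ∀ x : ℝ, HasDerivAt
        (fun x : ℝ => cexp (-(r : ℂ) * ((x : ℂ) + c * I) ^ 2))
        (-(2 * (r : ℂ)) *
          (((x : ℂ) + c * I) ^ (2 * 0 + 1) * cexp (-(r : ℂ) * ((x : ℂ) + c * I) ^ 2))) x := by
      intro x
      have h0 : HasDerivAt (fun x : ℝ => (x : ℂ) + c * I) 1 x :=
        (ofRealCLM.hasDerivAt (x := x)).add_const _
      refine (((h0.pow 2).const_mul (-(r : ℂ))).cexp).congr_deriv ?_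
      simp
      ring
    have h := integral_eq_zero_of_hasDerivAt_of_integrable hd
      ((integrable_shifted_pow_mul_gaussian hr c (2 * 0 + 1)).const_mul _)
      (by simpa using integrable_shifted_pow_mul_gaussian hr c 0)
    rw [integral_const_mul] at h
    simpa [hr'] using h
  | succ m ih =>
    have h := integral_shifted_pow_add_two hr c (2 * m + 1)
    rw [ih, mul_zero] at h
    simpa [hr', show 2 * (m + 1) + 1 = 2 * m + 1 + 2 by ring] using h

open Complex in
lemma integral_shifted_pow_even {r : ℝ} (hr : 0 < r) (c : ℝ) (m : ℕ) :
    ∫ x : ℝ, ((x : ℂ) + c * I) ^ (2 * m) * cexp (-(r : ℂ) * ((x : ℂ) + c * I) ^ 2) =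
      Gamma ((m : ℂ) + 1 / 2) * (r : ℂ) ^ (-((m : ℂ) + 1 / 2)) := by
  have hr' : (r : ℂ) ≠ 0 := by exact_mod_cast hr.ne'
  induction m with
  | zero =>
    have h := GaussianFourier.integral_cexp_neg_mul_sq_add_real_mul_I (b := r) (by simpa) c
    simp only [mul_zero, pow_zero, one_mul, h, Nat.cast_zero, zero_add, Gamma_one_half_eq]
    rw [← ofReal_div, div_eq_mul_inv, ofReal_mul,
      mul_cpow_ofReal_nonneg Real.pi_pos.le (inv_nonneg.2 hr.le), ofReal_inv,
      inv_cpow _ _ (by rw [arg_ofReal_of_nonneg hr.le]; exact Real.pi_pos.ne), cpow_neg]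
  | succ m ih =>
    have h := integral_shifted_pow_add_two hr c (2 * m)
    rw [ih] at h
    have hm : (m : ℂ) + 1 / 2 ≠ 0 := by
      intro h; have := congrArg Complex.re h; simp at this; linarith [(m.cast_nonneg : (0 : ℝ) ≤ m)]
    have e1 : ((m + 1 : ℕ) : ℂ) + 1 / 2 = ((m : ℂ) + 1 / 2) + 1 := by push_cast; ring
    have e2 : (r : ℂ) ^ (-((m : ℂ) + 1 / 2)) = r * (r : ℂ) ^ (-(((m : ℂ) + 1 / 2) + 1)) := by
      rw [show -((m : ℂ) + 1 / 2) = -(((m : ℂ) + 1 / 2) + 1) + 1 by ring, cpow_add _ _ hr',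
        cpow_one, mul_comm]
    rw [e1, Gamma_add_one _ hm, show 2 * (m + 1) = 2 * m + 2 by ring]
    rw [e2] at h
    apply mul_left_cancel₀ (mul_ne_zero two_ne_zero hr')
    rw [h]; push_cast; ring

/-- The Gaussian-damped polynomial `(x - σ i)^(2 * L) e^{-r(1+x²)}`. -/
noncomputable def gaussPoly (L : ℕ) (σ r x : ℝ) : ℂ :=
  ((x : ℂ) - σ * Complex.I) ^ (2 * L) * Complex.exp (-(r : ℂ) * (1 + (x : ℂ) ^ 2))

/-- The Fourier transform of `gaussPoly`. -/
noncomputable def gaussPolyFourier (L : ℕ) (σ r u : ℝ) : ℂ :=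
  ∑ j ∈ Finset.range (L + 1), (-1) ^ j * ((2 * L).choose (2 * j) : ℂ) *
    Complex.Gamma ((L : ℂ) - j + 1 / 2) * ((r : ℂ) ^ (-((L : ℂ) - j + 1 / 2)) *
      ((1 + σ * Real.pi * u / r : ℝ) : ℂ) ^ (2 * j) *
        Complex.exp (-((r : ℂ) + (Real.pi : ℂ) ^ 2 * (u : ℂ) ^ 2 / r)))

lemma sum_range_eq_sum_even {f : ℕ → ℂ} (hf : ∀ m, f (2 * m + 1) = 0) (L : ℕ) :
    ∑ k ∈ Finset.range (2 * L + 1), f k = ∑ j ∈ Finset.range (L + 1), f (2 * j) := by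
  induction L with
  | zero => simp
  | succ L ih =>
    rw [show 2 * (L + 1) + 1 = 2 * L + 1 + 1 + 1 by ring, Finset.sum_range_succ,
      Finset.sum_range_succ, ih, hf, Finset.sum_range_succ _ (L + 1)]
    simp [mul_add]

open Complex FourierTransform in
lemma fourier_gaussPoly (L : ℕ) {σ : ℝ} (hσ : σ ^ 2 = 1) {r : ℝ} (hr : 0 < r) (u : ℝ) :
    𝓕 (gaussPoly L σ r) u = gaussPolyFourier L σ r u := by
  have hr' : (r : ℂ) ≠ 0 := by exact_mod_cast hr.ne'
  set c : ℝ := Real.pi * u / r with hc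
  set a : ℂ := -((σ + c : ℝ) : ℂ) * I with ha
  set E : ℂ := cexp (-((r : ℂ) + (Real.pi : ℂ) ^ 2 * (u : ℂ) ^ 2 / r)) with hE
  have h1 : ∀ x : ℝ, cexp (↑(-2 * Real.pi * x * u) * I) • gaussPoly L σ r x =
      ∑ k ∈ Finset.range (2 * L + 1), (a ^ k * ((2 * L).choose k : ℂ) * E) *
        (((x : ℂ) + c * I) ^ (2 * L - k) * cexp (-(r : ℂ) * ((x : ℂ) + c * I) ^ 2)) := by
    intro x
    have e1 : (x : ℂ) - σ * I = a + ((x : ℂ) + c * I) := by rw [ha]; push_cast; ring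
    have e2 : cexp (↑(-2 * Real.pi * x * u) * I) * cexp (-(r : ℂ) * (1 + (x : ℂ) ^ 2)) =
        E * cexp (-(r : ℂ) * ((x : ℂ) + c * I) ^ 2) := by
      rw [hE, ← Complex.exp_add, ← Complex.exp_add, hc]
      congr 1
      push_cast
      field_simp
      linear_combination ((Real.pi : ℂ) ^ 2 * u ^ 2) * I_sq
    rw [gaussPoly, smul_eq_mul, e1, mul_left_comm, e2, add_pow, Finset.sum_mul]
    refine Finset.sum_congr rfl fun k _ => ?_
    ring
  rw [Real.fourier_real_eq_integral_exp_smul]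
  simp_rw [h1]
  rw [integral_finsetSum _ fun k _ => (integrable_shifted_pow_mul_gaussian hr c _).const_mul _]
  simp_rw [integral_const_mul]
  have h2 := sum_range_eq_sum_even (f := fun k => if k ≤ 2 * L then
    (a ^ k * ((2 * L).choose k : ℂ) * E) *
      ∫ x : ℝ, ((x : ℂ) + c * I) ^ (2 * L - k) * cexp (-(r : ℂ) * ((x : ℂ) + c * I) ^ 2) else 0)
    (fun m => by
      split_ifs with h
      · rw [show 2 * L - (2 * m + 1) = 2 * (L - m - 1) + 1 by omega,
          integral_shifted_pow_odd hr, mul_zero]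
      · rfl) L
  rw [Finset.sum_congr rfl fun k hk => if_pos (by simp at hk; omega)] at h2
  rw [h2, gaussPolyFourier]
  refine Finset.sum_congr rfl fun j hj => ?_
  have hj' : j ≤ L := by simp at hj; omega
  rw [if_pos (by omega), ← Nat.mul_sub, integral_shifted_pow_even hr, Nat.cast_sub hj']
  have e3 : a ^ (2 * j) = (-1) ^ j * ((1 + σ * Real.pi * u / r : ℝ) : ℂ) ^ (2 * j) := by
    have : a ^ 2 = (-1) * ((1 + σ * Real.pi * u / r : ℝ) : ℂ) ^ 2 := by
      have e4 : (σ + c) ^ 2 = (1 + σ * Real.pi * u / r) ^ 2 := by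
        rw [hc]
        have : σ * Real.pi * u / r = σ * (Real.pi * u / r) := by ring
        rw [this]; linear_combination (1 - (Real.pi * u / r) ^ 2) * hσ
      rw [ha, mul_pow, neg_sq, I_sq, ← ofReal_pow, e4]; push_cast; ring
    rw [pow_mul, this, mul_pow, pow_mul]
  rw [e3]
  ring

lemma continuous_gaussPoly (L : ℕ) (σ r : ℝ) : Continuous (gaussPoly L σ r) := by
  unfold gaussPoly; fun_prop

lemma integrable_gaussPoly (L : ℕ) (σ : ℝ) {r : ℝ} (hr : 0 < r) :
    Integrable (gaussPoly L σ r) := by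
  have h := fun k => integrable_shifted_pow_mul_gaussian hr 0 k
  have e : gaussPoly L σ r = fun x : ℝ => ∑ k ∈ Finset.range (2 * L + 1),
      ((-σ * Complex.I) ^ k * ((2 * L).choose k : ℂ) * Complex.exp (-(r : ℂ))) *
        (((x : ℂ) + (0 : ℝ) * Complex.I) ^ (2 * L - k) *
          Complex.exp (-(r : ℂ) * ((x : ℂ) + (0 : ℝ) * Complex.I) ^ 2)) := by
    ext x
    rw [gaussPoly, show (x : ℂ) - σ * Complex.I = -σ * Complex.I + x by ring, add_pow,
      Finset.sum_mul]
    refine Finset.sum_congr rfl fun k _ => ?_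
    rw [mul_add, Complex.exp_add]
    simp
    ring
  rw [e]
  exact integrable_finsetSum _ fun k _ => (h _).const_mul _

/-- Integrable weight in the Mellin variable. -/
noncomputable def mellinWeight (r : ℝ) : ℝ := r ^ (-7 / 8 : ℝ) * Real.exp (-(1 / 4) * r)

/-- Majorant in the frequency variable. -/
noncomputable def freqMajorant (u : ℝ) : ℝ := |u| ^ (-1 / 4 : ℝ) * Real.exp (-|u|)

/-- Majorant in the space variable. -/
noncomputable def spaceMajorant (x : ℝ) : ℝ := (1 + x ^ 2) ^ (-3 / 8 : ℝ)

lemma integrableOn_mellinWeight : IntegrableOn mellinWeight (Set.Ioi 0) := by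
  have := integrableOn_rpow_mul_exp_neg_mul_rpow (s := -7 / 8) (p := 1) (b := 1 / 4)
    (by norm_num) one_pos (by norm_num)
  exact this.congr_fun (fun r _ => by simp [mellinWeight]) measurableSet_Ioi

lemma integrable_comp_abs_of_integrableOn_Ioi {f : ℝ → ℝ} (hf : IntegrableOn f (Set.Ioi 0)) :
    Integrable fun x => f |x| := by
  have h1 : IntegrableOn (fun x => f |x|) (Set.Ioi 0) :=
    hf.congr_fun (fun x hx => by rw [abs_of_pos hx]) measurableSet_Ioi
  rw [← integrableOn_univ, ← Set.Iio_union_Ici (a := (0 : ℝ)), integrableOn_union,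
    integrableOn_Ici_iff_integrableOn_Ioi]
  refine ⟨?_, h1⟩
  rw [← (Measure.measurePreserving_neg (volume : Measure ℝ)).integrableOn_comp_preimage
      (Homeomorph.neg ℝ).measurableEmbedding]
  simpa [Function.comp_def] using! h1

lemma integrable_freqMajorant : Integrable freqMajorant := by
  have := integrableOn_rpow_mul_exp_neg_mul_rpow (s := -1 / 4) (p := 1) (b := 1)
    (by norm_num) one_pos (by norm_num)
  have h := integrable_comp_abs_of_integrableOn_Ioi this
  simpa [freqMajorant] using! h

lemma integrable_freqMajorant_sq : Integrable fun u => freqMajorant u ^ 2 := by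
  have := integrableOn_rpow_mul_exp_neg_mul_rpow (s := -1 / 2) (p := 1) (b := 2)
    (by norm_num) one_pos (by norm_num)
  have h := integrable_comp_abs_of_integrableOn_Ioi this
  refine h.congr (Filter.Eventually.of_forall fun u => ?_)
  simp only [freqMajorant]
  rw [mul_pow, ← Real.rpow_natCast (|u| ^ _), ← Real.rpow_mul (abs_nonneg u), ← Real.exp_nat_mul,
    Real.rpow_one]
  norm_num

lemma integrable_spaceMajorant_sq : Integrable fun x => spaceMajorant x ^ 2 := by
  have h := integrable_rpow_neg_one_add_norm_sq (E := ℝ) (μ := volume) (r := 3 / 2)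
    (by norm_num)
  refine h.congr (Filter.Eventually.of_forall fun u => ?_)
  simp only [spaceMajorant]
  rw [← Real.rpow_natCast ((1 + u ^ 2) ^ _), ← Real.rpow_mul (by positivity)]
  norm_num

lemma exp_neg_le_rpow_neg {y a : ℝ} (hy : 0 < y) (ha0 : 0 ≤ a) (ha : a ≤ 1) :
    Real.exp (-y) ≤ y ^ (-a) := by
  rw [Real.exp_neg, Real.rpow_neg hy.le]
  apply inv_anti₀ (by positivity)
  calc y ^ a ≤ (1 + y) ^ a := by gcongr; linarith
    _ ≤ (1 + y) ^ (1 : ℝ) := Real.rpow_le_rpow_of_exponent_le (by linarith) ha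
    _ ≤ Real.exp y := by rw [Real.rpow_one]; linarith [Real.add_one_le_exp y]

lemma pow_mul_exp_neg_le {w : ℝ} (hw : 0 ≤ w) (n : ℕ) :
    w ^ n * Real.exp (-w) ≤ 2 ^ n * n.factorial * Real.exp (-(w / 2)) := by
  have h := Real.pow_div_factorial_le_exp (x := w / 2) (by positivity) n
  rw [div_le_iff₀ (by positivity), div_pow, div_le_iff₀ (by positivity)] at h
  calc _ ≤ Real.exp (w / 2) * n.factorial * 2 ^ n * Real.exp (-w) := by gcongr
    _ = 2 ^ n * n.factorial * (Real.exp (w / 2) * Real.exp (-w)) := by ring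
    _ = _ := by rw [← Real.exp_add]; congr 2; ring

/-- The summands of the Mellin integrand defining the Kirillov vector. -/
noncomputable def kirillovTerm (ν : ℂ) (σ : ℝ) (j : ℕ) (r u : ℝ) : ℂ :=
  (r : ℂ) ^ (ν + j - 1) * ((1 + σ * Real.pi * u / r : ℝ) : ℂ) ^ (2 * j) *
    Complex.exp (-((r : ℂ) + (Real.pi : ℂ) ^ 2 * (u : ℂ) ^ 2 / r))

lemma norm_kirillovTerm_le {ν : ℂ} (hν : ν.re = 0) {σ : ℝ} (hσ : σ ^ 2 = 1) (j : ℕ) {r u : ℝ}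
    (hr : 0 < r) (hu : u ≠ 0) :
    ‖kirillovTerm ν σ j r u‖ ≤
      (2 ^ j * (2 ^ j * j.factorial)) * (mellinWeight r * freqMajorant u) := by
  set w : ℝ := r + Real.pi ^ 2 * u ^ 2 / r with hw
  have hu' : 0 < |u| := abs_pos.2 hu
  have hw0 : 0 < w := by positivity
  have e1 : ‖kirillovTerm ν σ j r u‖ =
      r⁻¹ * ((r * (1 + σ * Real.pi * u / r) ^ 2) ^ j * Real.exp (-w)) := by
    rw [kirillovTerm, norm_mul, norm_mul, norm_pow, Complex.norm_real, Complex.norm_exp,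
      Complex.norm_cpow_eq_rpow_re_of_pos hr, Real.norm_eq_abs, pow_mul, sq_abs]
    have : (-((r : ℂ) + (Real.pi : ℂ) ^ 2 * (u : ℂ) ^ 2 / r)) = ((-w : ℝ) : ℂ) := by
      rw [hw]; push_cast; ring
    rw [this, Complex.ofReal_re]
    have : (ν + j - 1).re = (j : ℝ) - 1 := by simp [hν]
    rw [this, Real.rpow_sub_one hr.ne', Real.rpow_natCast, mul_pow]
    ring
  have h1 : r * (1 + σ * Real.pi * u / r) ^ 2 ≤ 2 * w := by
    have : 2 * w - r * (1 + σ * Real.pi * u / r) ^ 2 = r * (1 - σ * Real.pi * u / r) ^ 2 := by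
      rw [hw]; field_simp; linear_combination (-2 * Real.pi ^ 2 * u ^ 2) * hσ
    have : 0 ≤ r * (1 - σ * Real.pi * u / r) ^ 2 := by positivity
    linarith
  have h2 : Real.exp (-(w / 2)) ≤
      Real.exp (-(1 / 4) * r) * Real.exp (-|u|) * Real.exp (-(u ^ 2 / r)) := by
    rw [← Real.exp_add, ← Real.exp_add]
    apply Real.exp_le_exp.2
    have hp : 4 ≤ Real.pi ^ 2 := by nlinarith [Real.pi_gt_three]
    have h3 : 2 * (u ^ 2 / r) + 2 * (u ^ 2 / r) ≤ Real.pi ^ 2 * u ^ 2 / r := by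
      rw [mul_div_assoc]
      have : 0 ≤ u ^ 2 / r := by positivity
      nlinarith
    have h4 : |u| ≤ r / 4 + u ^ 2 / r := by
      rw [← sub_nonneg]
      have : r / 4 + u ^ 2 / r - |u| = (r / 2 - |u|) ^ 2 / r := by
        field_simp; rw [← sq_abs u]; ring
      rw [this]; positivity
    rw [hw]; linarith
  have h3 : Real.exp (-(u ^ 2 / r)) ≤ r ^ (1 / 8 : ℝ) * |u| ^ (-1 / 4 : ℝ) := by
    refine (exp_neg_le_rpow_neg (a := 1 / 8) (by positivity) (by norm_num)
      (by norm_num)).trans_eq ?_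
    rw [Real.div_rpow (by positivity) hr.le, Real.rpow_neg hr.le, div_inv_eq_mul, mul_comm,
      ← sq_abs, ← Real.rpow_natCast, ← Real.rpow_mul (abs_nonneg u)]
    norm_num
  have e2 : r⁻¹ * r ^ (1 / 8 : ℝ) = r ^ (-7 / 8 : ℝ) := by
    rw [← Real.rpow_neg_one, ← Real.rpow_add hr]; norm_num
  rw [e1]
  calc _ ≤ r⁻¹ * ((2 * w) ^ j * Real.exp (-w)) := by gcongr
    _ = r⁻¹ * (2 ^ j * (w ^ j * Real.exp (-w))) := by rw [mul_pow]; ring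
    _ ≤ r⁻¹ * (2 ^ j * (2 ^ j * j.factorial * (Real.exp (-(1 / 4) * r) * Real.exp (-|u|) *
          (r ^ (1 / 8 : ℝ) * |u| ^ (-1 / 4 : ℝ))))) := by
        have := (pow_mul_exp_neg_le hw0.le j).trans
          (mul_le_mul_of_nonneg_left (h2.trans (mul_le_mul_of_nonneg_left h3 (by positivity)))
            (by positivity))
        gcongr
    _ = _ := by rw [mellinWeight, freqMajorant, ← e2]; ring

lemma norm_cpow_mul_gaussPoly_le {ν : ℂ} (hν : ν.re = 0) {σ : ℝ} (hσ : σ ^ 2 = 1) (L : ℕ)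
    {r : ℝ} (hr : 0 < r) (x : ℝ) :
    ‖(r : ℂ) ^ (ν + L + 1 / 2 - 1) * gaussPoly L σ r x‖ ≤
      (2 ^ L * L.factorial * 4 ^ (3 / 8 : ℝ)) * (mellinWeight r * spaceMajorant x) := by
  set q : ℝ := r * (1 + x ^ 2) with hq
  have hq0 : 0 < q := by positivity
  have e1 : ‖(r : ℂ) ^ (ν + L + 1 / 2 - 1) * gaussPoly L σ r x‖ =
      r ^ (-1 / 2 : ℝ) * (q ^ L * Real.exp (-q)) := by
    have e2 : ‖(x : ℂ) - σ * Complex.I‖ ^ 2 = 1 + x ^ 2 := by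
      rw [← Complex.normSq_eq_norm_sq, Complex.normSq_apply]; simp; linarith
    have e3 : (ν + L + 1 / 2 - 1).re = -1 / 2 + (L : ℝ) := by simp [hν]; ring
    have e4 : -(r : ℂ) * (1 + (x : ℂ) ^ 2) = ((-q : ℝ) : ℂ) := by rw [hq]; push_cast; ring
    rw [gaussPoly, norm_mul, norm_mul, norm_pow, pow_mul, e2, e4, Complex.norm_exp,
      Complex.ofReal_re, Complex.norm_cpow_eq_rpow_re_of_pos hr, e3, Real.rpow_add hr,
      Real.rpow_natCast, hq, mul_pow]
    ring
  have h2 : Real.exp (-(q / 2)) ≤ Real.exp (-(1 / 4) * r) * Real.exp (-(q / 4)) := by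
    rw [← Real.exp_add]
    apply Real.exp_le_exp.2
    have : r ≤ q := by rw [hq]; nlinarith [sq_nonneg x]
    linarith
  have h3 : Real.exp (-(q / 4)) ≤
      4 ^ (3 / 8 : ℝ) * (r ^ (-3 / 8 : ℝ) * (1 + x ^ 2) ^ (-3 / 8 : ℝ)) := by
    refine (exp_neg_le_rpow_neg (a := 3 / 8) (by positivity) (by norm_num)
      (by norm_num)).trans_eq ?_
    rw [Real.div_rpow (by positivity) (by norm_num), Real.rpow_neg (by norm_num : (0 : ℝ) ≤ 4),
      div_inv_eq_mul, mul_comm, hq, Real.mul_rpow hr.le (by positivity)]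
    norm_num
  have e2 : r ^ (-1 / 2 : ℝ) * r ^ (-3 / 8 : ℝ) = r ^ (-7 / 8 : ℝ) := by
    rw [← Real.rpow_add hr]; norm_num
  rw [e1]
  calc _ ≤ r ^ (-1 / 2 : ℝ) * (2 ^ L * L.factorial * (Real.exp (-(1 / 4) * r) *
          (4 ^ (3 / 8 : ℝ) * (r ^ (-3 / 8 : ℝ) * (1 + x ^ 2) ^ (-3 / 8 : ℝ))))) := by
        have := (pow_mul_exp_neg_le hq0.le L).trans
          (mul_le_mul_of_nonneg_left (h2.trans (mul_le_mul_of_nonneg_left h3 (by positivity)))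
            (by positivity))
        gcongr
    _ = _ := by rw [mellinWeight, spaceMajorant, ← e2]; ring

lemma volume_restrict_compl_singleton (a : ℝ) : volume.restrict ({a}ᶜ : Set ℝ) = volume :=
  Measure.restrict_eq_self_of_ae_mem (by simp [ae_iff])

/-- The constant coefficients in the Fourier transform of `gaussPoly`. -/
noncomputable def kirillovCoeff (L j : ℕ) : ℂ :=
  (-1) ^ j * ((2 * L).choose (2 * j) : ℂ) * Complex.Gamma ((L : ℂ) - j + 1 / 2)

lemma cpow_mul_gaussPolyFourier (ν : ℂ) (L : ℕ) (σ : ℝ) {r : ℝ} (hr : 0 < r) (u : ℝ) :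
    (r : ℂ) ^ (ν + L + 1 / 2 - 1) * gaussPolyFourier L σ r u =
      ∑ j ∈ Finset.range (L + 1), kirillovCoeff L j * kirillovTerm ν σ j r u := by
  have hr' : (r : ℂ) ≠ 0 := by exact_mod_cast hr.ne'
  rw [gaussPolyFourier, Finset.mul_sum]
  refine Finset.sum_congr rfl fun j _ => ?_
  rw [kirillovCoeff, kirillovTerm, show ν + j - 1 = (ν + L + 1 / 2 - 1) + (-((L : ℂ) - j + 1 / 2))
    by ring, Complex.cpow_add _ _ hr']
  ring

lemma norm_cpow_mul_gaussPolyFourier_le (L : ℕ) {σ : ℝ} (hσ : σ ^ 2 = 1) :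
    ∃ C : ℝ, ∀ ν : ℂ, ν.re = 0 → ∀ r : ℝ, 0 < r → ∀ u : ℝ, u ≠ 0 →
      ‖(r : ℂ) ^ (ν + L + 1 / 2 - 1) * gaussPolyFourier L σ r u‖ ≤
        C * (mellinWeight r * freqMajorant u) := by
  refine ⟨∑ j ∈ Finset.range (L + 1), ‖kirillovCoeff L j‖ * (2 ^ j * (2 ^ j * j.factorial)),
    fun ν hν r hr u hu => ?_⟩
  rw [cpow_mul_gaussPolyFourier ν L σ hr u, Finset.sum_mul]
  refine (norm_sum_le _ _).trans (Finset.sum_le_sum fun j _ => ?_)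
  rw [norm_mul, mul_assoc]
  exact mul_le_mul_of_nonneg_left (norm_kirillovTerm_le hν hσ j hr hu) (norm_nonneg _)

lemma integrable_gaussPolyFourier (L : ℕ) {σ : ℝ} (hσ : σ ^ 2 = 1) {r : ℝ} (hr : 0 < r) :
    Integrable (gaussPolyFourier L σ r) := by
  have hr' : (r : ℂ) ^ ((0 : ℂ) + L + 1 / 2 - 1) ≠ 0 := by
    rw [Ne, Complex.cpow_eq_zero_iff]; simp [hr.ne']
  obtain ⟨C, hC⟩ := norm_cpow_mul_gaussPolyFourier_le L hσ
  rw [← integrable_const_mul_iff (IsUnit.mk0 _ hr')]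
  refine ((integrable_freqMajorant.const_mul (C * mellinWeight r))).mono' ?_ ?_
  · unfold gaussPolyFourier
    exact Measurable.aestronglyMeasurable (by fun_prop)
  · have h0 : ∀ᵐ u : ℝ, u ≠ 0 := by simp [ae_iff]
    filter_upwards [h0] with u hu
    rw [mul_assoc]
    exact hC 0 rfl r hr u hu

open FourierTransform in
/-- Parseval's identity for continuous integrable functions with integrable Fourier transform. -/
lemma integral_fourier_mul_conj_fourier {f g : ℝ → ℂ} (hf : Integrable f) (hg : Integrable g)
    (hgc : Continuous g) (hg' : Integrable (𝓕 g)) :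
    ∫ u, 𝓕 f u * (starRingEnd ℂ) (𝓕 g u) = ∫ x, f x * (starRingEnd ℂ) (g x) := by
  have h := VectorFourier.integral_sesq_fourierIntegral_eq_neg_flip (μ := volume) (ν := volume)
    (L := innerₗ ℝ) (f := f) (g := 𝓕 g) (innerSL ℂ)
    Real.continuous_fourierChar continuous_inner hf hg'
  have h2 : ∀ x, VectorFourier.fourierIntegral Real.fourierChar volume (-(innerₗ ℝ).flip)
      (𝓕 g) x = g x := by
    intro x
    have e := congrFun (hgc.fourierInv_fourier_eq hg hg') x
    rw [← e, Real.fourierInv_eq, VectorFourier.fourierIntegral]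
    simp
  simp_rw [h2] at h
  have h3 := congrArg (starRingEnd ℂ) h
  rw [← integral_conj, ← integral_conj] at h3
  simp only [innerSL_apply_apply, RCLike.inner_apply, map_mul, Complex.conj_conj] at h3
  simp_rw [mul_comm ((starRingEnd ℂ) _)] at h3
  exact h3

lemma integral_gaussPolyFourier_mul_conj (L L' : ℕ) {σ σ' : ℝ} (hσ : σ ^ 2 = 1)
    (hσ' : σ' ^ 2 = 1) {r r' : ℝ} (hr : 0 < r) (hr' : 0 < r') :
    ∫ u, gaussPolyFourier L σ r u * (starRingEnd ℂ) (gaussPolyFourier L' σ' r' u) =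
      ∫ x, gaussPoly L σ r x * (starRingEnd ℂ) (gaussPoly L' σ' r' x) := by
  have e : FourierTransform.fourier (gaussPoly L σ r) = gaussPolyFourier L σ r :=
    funext (fourier_gaussPoly L hσ hr)
  have e' : FourierTransform.fourier (gaussPoly L' σ' r') = gaussPolyFourier L' σ' r' :=
    funext (fourier_gaussPoly L' hσ' hr')
  have h := integral_fourier_mul_conj_fourier (integrable_gaussPoly L σ hr)
    (integrable_gaussPoly L' σ' hr') (continuous_gaussPoly L' σ' r')
    (e' ▸ integrable_gaussPolyFourier L' hσ' hr')
  rwa [e, e'] at h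

lemma integral_mul_conj_integral {A B : ℝ → ℝ → ℂ} {k H : ℝ → ℝ} {S T : Set ℝ}
    (hS : MeasurableSet S) (hT : MeasurableSet T) (hA : Measurable (Function.uncurry A))
    (hB : Measurable (Function.uncurry B)) (hk : IntegrableOn k S)
    (hH : IntegrableOn (fun x => H x ^ 2) T) {a b : ℝ}
    (bA : ∀ r ∈ S, ∀ x ∈ T, ‖A r x‖ ≤ a * (k r * H x))
    (bB : ∀ r ∈ S, ∀ x ∈ T, ‖B r x‖ ≤ b * (k r * H x)) :
    IntegrableOn (fun x => (∫ r in S, A r x) * (starRingEnd ℂ) (∫ r in S, B r x)) T ∧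
    ∫ x in T, (∫ r in S, A r x) * (starRingEnd ℂ) (∫ r in S, B r x) =
      ∫ p in S ×ˢ S, ∫ x in T, A p.1 x * (starRingEnd ℂ) (B p.2 x) := by
  have e : ∀ x, (∫ r in S, A r x) * (starRingEnd ℂ) (∫ r in S, B r x) =
      ∫ p in S ×ˢ S, A p.1 x * (starRingEnd ℂ) (B p.2 x) := by
    intro x
    rw [← integral_conj, Measure.volume_eq_prod, ← Measure.prod_restrict]
    exact (integral_prod_mul (fun r => A r x) (fun r => (starRingEnd ℂ) (B r x))).symm
  simp_rw [e]
  have hF : Integrable (Function.uncurry fun (p : ℝ × ℝ) (x : ℝ) =>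
      A p.1 x * (starRingEnd ℂ) (B p.2 x))
      ((volume.restrict (S ×ˢ S)).prod (volume.restrict T)) := by
    have hb : Integrable (fun z : (ℝ × ℝ) × ℝ => (a * b * (k z.1.1 * k z.1.2)) * H z.2 ^ 2)
        ((volume.restrict (S ×ˢ S)).prod (volume.restrict T)) := by
      refine Integrable.mul_prod (f := fun p : ℝ × ℝ => a * b * (k p.1 * k p.2)) ?_ hH
      rw [Measure.volume_eq_prod, ← Measure.prod_restrict]
      exact (Integrable.mul_prod hk hk).const_mul _
    refine hb.mono' ?_ ?_
    · refine Measurable.aestronglyMeasurable ?_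
      have h1 : Measurable fun z : (ℝ × ℝ) × ℝ => A z.1.1 z.2 :=
        hA.comp (measurable_fst.fst.prodMk measurable_snd)
      have h2 : Measurable fun z : (ℝ × ℝ) × ℝ => B z.1.2 z.2 :=
        hB.comp (measurable_fst.snd.prodMk measurable_snd)
      exact h1.mul (Complex.continuous_conj.measurable.comp h2)
    · rw [Measure.prod_restrict]
      refine ae_restrict_of_forall_mem ((hS.prod hS).prod hT) ?_
      rintro ⟨⟨r, r'⟩, x⟩ ⟨⟨hr, hr'⟩, hx⟩
      simp only [Function.uncurry, norm_mul, RCLike.norm_conj]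
      refine (mul_le_mul (bA r hr x hx) (bB r' hr' x hx) (norm_nonneg _)
        ((norm_nonneg _).trans (bA r hr x hx))).trans_eq ?_
      ring
  exact ⟨hF.integral_prod_right, (integral_integral_swap hF).symm⟩

/-- Plancherel's identity for Mellin superpositions of `gaussPoly`. -/
lemma integral_mellin_gaussPolyFourier {ν ν' : ℂ} (hν : ν.re = 0) (hν' : ν'.re = 0) (L L' : ℕ)
    {σ σ' : ℝ} (hσ : σ ^ 2 = 1) (hσ' : σ' ^ 2 = 1) :
    Integrable (fun u : ℝ =>
      (∫ r in Set.Ioi (0 : ℝ), (r : ℂ) ^ (ν + L + 1 / 2 - 1) * gaussPolyFourier L σ r u) *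
      (starRingEnd ℂ)
        (∫ r in Set.Ioi (0 : ℝ), (r : ℂ) ^ (ν' + L' + 1 / 2 - 1) * gaussPolyFourier L' σ' r u)) ∧
    ∫ u : ℝ,
      (∫ r in Set.Ioi (0 : ℝ), (r : ℂ) ^ (ν + L + 1 / 2 - 1) * gaussPolyFourier L σ r u) *
      (starRingEnd ℂ)
        (∫ r in Set.Ioi (0 : ℝ), (r : ℂ) ^ (ν' + L' + 1 / 2 - 1) * gaussPolyFourier L' σ' r u) =
    ∫ x : ℝ,
      (∫ r in Set.Ioi (0 : ℝ), (r : ℂ) ^ (ν + L + 1 / 2 - 1) * gaussPoly L σ r x) *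
      (starRingEnd ℂ)
        (∫ r in Set.Ioi (0 : ℝ), (r : ℂ) ^ (ν' + L' + 1 / 2 - 1) * gaussPoly L' σ' r x) := by
  have m1 : ∀ (ν : ℂ) (L : ℕ) (σ : ℝ), Measurable (Function.uncurry fun r u : ℝ =>
      (r : ℂ) ^ (ν + L + 1 / 2 - 1) * gaussPolyFourier L σ r u) := by
    intro ν L σ
    unfold gaussPolyFourier Function.uncurry
    fun_prop
  have m2 : ∀ (ν : ℂ) (L : ℕ) (σ : ℝ), Measurable (Function.uncurry fun r u : ℝ =>
      (r : ℂ) ^ (ν + L + 1 / 2 - 1) * gaussPoly L σ r u) := by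
    intro ν L σ
    unfold gaussPoly Function.uncurry
    fun_prop
  obtain ⟨C, hC⟩ := norm_cpow_mul_gaussPolyFourier_le L hσ
  obtain ⟨C', hC'⟩ := norm_cpow_mul_gaussPolyFourier_le L' hσ'
  have h1 := integral_mul_conj_integral (T := {0}ᶜ) measurableSet_Ioi
    (measurableSet_singleton 0).compl (m1 ν L σ) (m1 ν' L' σ') integrableOn_mellinWeight
    integrable_freqMajorant_sq.integrableOn (fun r hr u hu => hC ν hν r hr u hu)
    (fun r hr u hu => hC' ν' hν' r hr u hu)
  have h2 := integral_mul_conj_integral (T := Set.univ) measurableSet_Ioi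
    MeasurableSet.univ (m2 ν L σ) (m2 ν' L' σ') integrableOn_mellinWeight
    integrable_spaceMajorant_sq.integrableOn
    (fun r hr x _ => norm_cpow_mul_gaussPoly_le hν hσ L hr x)
    (fun r hr x _ => norm_cpow_mul_gaussPoly_le hν' hσ' L' hr x)
  simp only [IntegrableOn, volume_restrict_compl_singleton] at h1
  simp only [Measure.restrict_univ] at h2
  refine ⟨h1.1, h1.2.trans (Eq.trans ?_ h2.2.symm)⟩
  refine setIntegral_congr_fun (measurableSet_Ioi.prod measurableSet_Ioi) ?_
  rintro ⟨r, r'⟩ ⟨hr, hr'⟩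
  have h := integral_gaussPolyFourier_mul_conj L L' hσ hσ' hr hr'
  have e : ∀ a b c d : ℂ, a * b * (starRingEnd ℂ) (c * d) =
      (a * (starRingEnd ℂ) c) * (b * (starRingEnd ℂ) d) := by
    intro a b c d; rw [map_mul]; ring
  simp only [e, integral_const_mul, h]

lemma integrableOn_kirillovTerm {ν : ℂ} (hν : ν.re = 0) {σ : ℝ} (hσ : σ ^ 2 = 1) (j : ℕ) {u : ℝ}
    (hu : u ≠ 0) : IntegrableOn (fun r => kirillovTerm ν σ j r u) (Set.Ioi 0) := by
  refine Integrable.mono' ((integrableOn_mellinWeight.mul_const (freqMajorant u)).const_mul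
    (2 ^ j * (2 ^ j * j.factorial))) ?_ (ae_restrict_of_forall_mem measurableSet_Ioi
      fun r hr => norm_kirillovTerm_le hν hσ j hr hu)
  unfold kirillovTerm
  exact Measurable.aestronglyMeasurable (by fun_prop)

lemma integral_kirillovTerm (ν : ℂ) {σ τ : ℝ} (j : ℕ) {u : ℝ}
    (hu : u ≠ 0) (hτ : j = 0 ∨ σ * u = τ * |u|) :
    ∫ r in Set.Ioi (0 : ℝ), kirillovTerm ν σ j r u =
      ((Real.pi * |u| : ℝ) : ℂ) ^ (ν + j) * ∫ t in Set.Ioi (0 : ℝ),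
          (t : ℂ) ^ (ν - 1) *
            (((Real.sqrt t + τ / Real.sqrt t) ^ (2 * j) : ℝ) : ℂ) *
            (Real.exp (-(Real.pi * |u| * (t + 1 / t))) : ℂ) := by
  have hu' : 0 < |u| := abs_pos.2 hu
  set b : ℝ := Real.pi * |u| with hb
  have hb0 : 0 < b := by positivity
  have hbc : (b : ℂ) ≠ 0 := by exact_mod_cast hb0.ne'
  have h := integral_comp_mul_left_Ioi (fun r => kirillovTerm ν σ j r u) 0 hb0
  rw [mul_zero, eq_inv_smul_iff₀ hb0.ne'] at h
  rw [← h, Complex.real_smul, ← integral_const_mul, ← integral_const_mul]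
  refine setIntegral_congr_fun measurableSet_Ioi fun t ht => ?_
  have ht : 0 < t := ht
  have htc : (t : ℂ) ≠ 0 := by exact_mod_cast ht.ne'
  have e1 : (1 + σ * Real.pi * u / (b * t)) ^ (2 * j) * t ^ j =
      (Real.sqrt t + τ / Real.sqrt t) ^ (2 * j) := by
    rcases hτ with rfl | hτ
    · simp
    · have e2 : σ * Real.pi * u / (b * t) = τ / t := by
        rw [hb]; field_simp; rw [hτ, mul_comm]
      have hs : 0 < Real.sqrt t := Real.sqrt_pos.2 ht
      have e3 : Real.sqrt t + τ / Real.sqrt t = Real.sqrt t * (1 + τ / t) := by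
        rw [mul_add, mul_div_assoc']
        nth_rewrite 5 [← Real.mul_self_sqrt ht.le]
        field_simp
      rw [e2, e3, mul_pow, pow_mul (Real.sqrt t), Real.sq_sqrt ht.le, mul_comm]
  have e4 : ((b * t : ℝ) : ℂ) ^ (ν + j - 1) * b =
      (b : ℂ) ^ (ν + j) * ((t : ℂ) ^ (ν - 1) * (t : ℂ) ^ j) := by
    rw [Complex.ofReal_mul, Complex.mul_cpow_ofReal_nonneg hb0.le ht.le,
      show ν + j - 1 = (ν - 1) + j by ring, Complex.cpow_add _ _ htc, Complex.cpow_natCast,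
      show ν + (j : ℂ) = (ν - 1 + j) + 1 by ring, Complex.cpow_add (ν - 1 + j) 1 hbc,
      Complex.cpow_one]
    ring
  have e5 : Complex.exp (-(((b * t : ℝ) : ℂ) + (Real.pi : ℂ) ^ 2 * (u : ℂ) ^ 2 / ((b * t : ℝ) : ℂ)))
      = (Real.exp (-(b * (t + 1 / t))) : ℂ) := by
    have : b * t + Real.pi ^ 2 * u ^ 2 / (b * t) = b * (t + 1 / t) := by
      have : Real.pi ^ 2 * u ^ 2 = b ^ 2 := by rw [hb, mul_pow, sq_abs]
      rw [this]; field_simp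
    rw [← this]; push_cast; rfl
  simp only [kirillovTerm]
  rw [e5, ← e1]
  push_cast at e4 ⊢
  linear_combination ((1 + (σ : ℂ) * Real.pi * u / (b * t)) ^ (2 * j) *
    Complex.exp (-(b * (t + 1 / t)))) * e4

/-- The sign of an integer, with the convention that it is `1` at zero. -/
noncomputable def intSign (ℓ : ℤ) : ℝ := if 0 ≤ ℓ then 1 else -1

lemma intSign_sq (ℓ : ℤ) : intSign ℓ ^ 2 = 1 := by
  unfold intSign; split_ifs <;> norm_num

lemma intSign_mul_eq_sign {ℓ : ℤ} (hℓ : ℓ ≠ 0) (u : ℝ) :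
    intSign ℓ * u = Real.sign (u * ℓ) * |u| := by
  rcases lt_trichotomy u 0 with hu | rfl | hu
  · rcases lt_or_gt_of_ne hℓ with h | h
    · rw [Real.sign_of_pos (mul_pos_of_neg_of_neg hu (by exact_mod_cast h)), abs_of_neg hu,
        intSign, if_neg (by omega)]; ring
    · rw [Real.sign_of_neg (mul_neg_of_neg_of_pos hu (by exact_mod_cast h)), abs_of_neg hu,
        intSign, if_pos h.le]; ring
  · simp
  · rcases lt_or_gt_of_ne hℓ with h | h
    · rw [Real.sign_of_neg (mul_neg_of_pos_of_neg hu (by exact_mod_cast h)), abs_of_pos hu,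
        intSign, if_neg (by omega)]
    · rw [Real.sign_of_pos (mul_pos hu (by exact_mod_cast h)), abs_of_pos hu,
        intSign, if_pos h.le]

lemma Kvec_eq_integral (ℓ : ℤ) {ν : ℂ} (hν : ν.re = 0) {u : ℝ} (hu : u ≠ 0) :
    Kvec ℓ ν u = ((|u| : ℝ) : ℂ) ^ (1 / 2 - ν) / Complex.Gamma (ν + (ℓ.natAbs : ℂ) + 1 / 2) *
      ∫ r in Set.Ioi (0 : ℝ), (r : ℂ) ^ (ν + ℓ.natAbs + 1 / 2 - 1) *
        gaussPolyFourier ℓ.natAbs (intSign ℓ) r u := by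
  have hu' : 0 < |u| := abs_pos.2 hu
  have huc : ((|u| : ℝ) : ℂ) ≠ 0 := by exact_mod_cast hu'.ne'
  have hpi : (Real.pi : ℂ) ≠ 0 := by exact_mod_cast Real.pi_ne_zero
  rw [setIntegral_congr_fun measurableSet_Ioi fun r hr =>
    cpow_mul_gaussPolyFourier ν ℓ.natAbs (intSign ℓ) hr u,
    integral_finsetSum _ fun j _ =>
      (integrableOn_kirillovTerm hν (intSign_sq ℓ) j hu).const_mul _, Kvec,
    Finset.mul_sum, Finset.mul_sum]
  refine Finset.sum_congr rfl fun j hj => ?_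
  rw [integral_const_mul, integral_kirillovTerm ν (τ := Real.sign (u * (ℓ : ℝ))) j hu]
  · rw [kirillovCoeff, neg_pow, Complex.ofReal_mul,
      Complex.mul_cpow_ofReal_nonneg Real.pi_pos.le hu'.le, Complex.cpow_add _ _ hpi,
      Complex.cpow_natCast, show (j : ℂ) + 1 / 2 = (1 / 2 - ν) + (ν + j) by ring,
      Complex.cpow_add _ _ huc]
    ring
  · rcases eq_or_ne ℓ 0 with rfl | h
    · left; simpa using hj
    · right; exact intSign_mul_eq_sign h u

/-- The Cayley transform of the real line onto the unit circle. -/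
noncomputable def cayley (x : ℝ) : ℂ := ((x : ℂ) - Complex.I) / ((x : ℂ) + Complex.I)

lemma ofReal_sub_I_ne_zero (x : ℝ) : (x : ℂ) - Complex.I ≠ 0 := by
  intro h; simpa using congrArg Complex.im h

lemma ofReal_add_I_ne_zero (x : ℝ) : (x : ℂ) + Complex.I ≠ 0 := by
  intro h; simpa using congrArg Complex.im h

lemma cayley_ne_zero (x : ℝ) : cayley x ≠ 0 :=
  div_ne_zero (ofReal_sub_I_ne_zero x) (ofReal_add_I_ne_zero x)

lemma one_add_sq_eq (x : ℝ) :
    (1 + (x : ℂ) ^ 2) = ((x : ℂ) - Complex.I) * ((x : ℂ) + Complex.I) := by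
  linear_combination Complex.I_sq

lemma conj_cayley (x : ℝ) : (starRingEnd ℂ) (cayley x) = (cayley x)⁻¹ := by
  simp [cayley, ← sub_eq_add_neg]

lemma norm_cayley (x : ℝ) : ‖cayley x‖ = 1 := by
  have h := Complex.mul_conj' (cayley x)
  rw [conj_cayley, mul_inv_cancel₀ (cayley_ne_zero x)] at h
  have : ‖cayley x‖ ^ 2 = 1 := by exact_mod_cast h.symm
  nlinarith [norm_nonneg (cayley x)]

lemma hasDerivAt_cayley (x : ℝ) :
    HasDerivAt cayley (2 * Complex.I * cayley x / (1 + (x : ℂ) ^ 2)) x := by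
  have h0 : HasDerivAt (fun x : ℝ => (x : ℂ)) 1 x := Complex.ofRealCLM.hasDerivAt (x := x)
  have h := (h0.sub_const Complex.I).div (h0.add_const Complex.I) (ofReal_add_I_ne_zero x)
  refine h.congr_deriv ?_
  rw [one_add_sq_eq, cayley]
  have := ofReal_add_I_ne_zero x
  have := ofReal_sub_I_ne_zero x
  field_simp
  ring

lemma tendsto_cayley {l : Filter ℝ} (hl : Filter.Tendsto (fun x : ℝ => |x|) l Filter.atTop) :
    Filter.Tendsto cayley l (nhds 1) := by
  have e : cayley = fun x : ℝ => 1 - 2 * Complex.I / ((x : ℂ) + Complex.I) := by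
    ext x
    rw [cayley]
    have := ofReal_add_I_ne_zero x
    field_simp
    ring
  have h1 : Filter.Tendsto (fun x : ℝ => ‖(x : ℂ) + Complex.I‖) l Filter.atTop := by
    refine Filter.tendsto_atTop_mono (fun x => ?_) hl
    simpa using Complex.abs_re_le_norm ((x : ℂ) + Complex.I)
  have h2 : Filter.Tendsto (fun x : ℝ => 2 * Complex.I / ((x : ℂ) + Complex.I)) l (nhds 0) := by
    rw [tendsto_zero_iff_norm_tendsto_zero]
    simp_rw [norm_div]
    exact h1.const_div_atTop _
  rw [e]
  simpa using h2.const_sub (1 : ℂ)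

lemma integral_cayley_zpow (m : ℤ) :
    ∫ x : ℝ, cayley x ^ m / (1 + (x : ℂ) ^ 2) = if m = 0 then (Real.pi : ℂ) else 0 := by
  split_ifs with hm
  · subst hm
    have h := integral_univ_inv_one_add_sq
    rw [← h, ← integral_complex_ofReal]
    refine integral_congr_ae (Filter.Eventually.of_forall fun x => ?_)
    simp
  · have hmc : (m : ℂ) ≠ 0 := by exact_mod_cast hm
    have hcont : Continuous cayley :=
      continuous_iff_continuousAt.2 fun x => (hasDerivAt_cayley x).continuousAt
    have h_int : Integrable fun x : ℝ => cayley x ^ m / (1 + (x : ℂ) ^ 2) := by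
      refine integrable_inv_one_add_sq.mono' ?_ (Filter.Eventually.of_forall fun x => ?_)
      · refine Continuous.aestronglyMeasurable ?_
        refine (hcont.zpow₀ m fun x => Or.inl (cayley_ne_zero x)).div (by fun_prop) fun x => ?_
        rw [one_add_sq_eq]
        exact mul_ne_zero (ofReal_sub_I_ne_zero x) (ofReal_add_I_ne_zero x)
      · rw [norm_div, norm_zpow, norm_cayley, one_zpow, one_div]
        have : (1 + (x : ℂ) ^ 2) = ((1 + x ^ 2 : ℝ) : ℂ) := by push_cast; rfl
        rw [this, Complex.norm_real, Real.norm_of_nonneg (by positivity)]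
    have hd : ∀ x : ℝ, HasDerivAt (fun x => cayley x ^ m)
        (2 * Complex.I * m * (cayley x ^ m / (1 + (x : ℂ) ^ 2))) x := by
      intro x
      refine ((hasDerivAt_zpow m (cayley x) (Or.inl (cayley_ne_zero x))).comp x
        (hasDerivAt_cayley x)).congr_deriv ?_
      rw [zpow_sub_one₀ (cayley_ne_zero x)]
      have := cayley_ne_zero x
      field_simp
    have ht : ∀ {l : Filter ℝ}, Filter.Tendsto (fun x : ℝ => |x|) l Filter.atTop →
        Filter.Tendsto (fun x => cayley x ^ m) l (nhds 1) := by
      intro l hl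
      simpa using (tendsto_cayley hl).zpow₀ m (Or.inl one_ne_zero)
    have h := integral_of_hasDerivAt_of_tendsto hd (h_int.const_mul _)
      (ht Filter.tendsto_abs_atBot_atTop) (ht Filter.tendsto_abs_atTop_atTop)
    rw [integral_const_mul, sub_self] at h
    simpa [hmc] using h

lemma integral_cpow_mul_gaussPoly {ν : ℂ} (hν : ν.re = 0) (ℓ : ℤ) (x : ℝ) :
    ∫ r in Set.Ioi (0 : ℝ), (r : ℂ) ^ (ν + ℓ.natAbs + 1 / 2 - 1) *
        gaussPoly ℓ.natAbs (intSign ℓ) r x =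
      Complex.Gamma (ν + ℓ.natAbs + 1 / 2) *
        (cayley x ^ ℓ * ((1 + x ^ 2 : ℝ) : ℂ) ^ (-(ν + 1 / 2))) := by
  set L := ℓ.natAbs with hL
  have hx : 0 < 1 + x ^ 2 := by positivity
  have hxc : ((1 + x ^ 2 : ℝ) : ℂ) ≠ 0 := by exact_mod_cast hx.ne'
  have hre : 0 < (ν + L + 1 / 2).re := by simp [hν]; positivity
  have h := Complex.integral_cpow_mul_exp_neg_mul_Ioi hre hx
  have e1 : ∀ r : ℝ, (r : ℂ) ^ (ν + L + 1 / 2 - 1) * gaussPoly L (intSign ℓ) r x =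
      ((x : ℂ) - intSign ℓ * Complex.I) ^ (2 * L) * ((r : ℂ) ^ (ν + L + 1 / 2 - 1) *
        Complex.exp (-(((1 + x ^ 2 : ℝ) : ℂ) * r))) := by
    intro r
    rw [gaussPoly, show -(r : ℂ) * (1 + (x : ℂ) ^ 2) = -(((1 + x ^ 2 : ℝ) : ℂ) * r) by
      push_cast; ring]
    ring
  have e2 : ((x : ℂ) - intSign ℓ * Complex.I) ^ (2 * L) =
      cayley x ^ ℓ * ((1 + x ^ 2 : ℝ) : ℂ) ^ L := by
    have e3 : ((1 + x ^ 2 : ℝ) : ℂ) = ((x : ℂ) - Complex.I) * ((x : ℂ) + Complex.I) := by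
      rw [← one_add_sq_eq]; push_cast; rfl
    have h1 := ofReal_add_I_ne_zero x
    have h2 := ofReal_sub_I_ne_zero x
    rw [e3, intSign]
    split_ifs with h0
    · rw [show ℓ = (L : ℤ) by omega, zpow_natCast, cayley, pow_mul, ← mul_pow]
      congr 1
      push_cast
      field_simp
    · rw [show ℓ = -(L : ℤ) by omega, zpow_neg, zpow_natCast, ← inv_pow, cayley, pow_mul,
        ← mul_pow]
      congr 1
      push_cast
      field_simp
      ring
  simp_rw [e1]
  rw [integral_const_mul, h, e2, one_div, Complex.inv_cpow _ _ (by
    rw [Complex.arg_ofReal_of_nonneg hx.le]; exact Real.pi_pos.ne), ← Complex.cpow_neg,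
    show -(ν + 1 / 2) = -(ν + L + 1 / 2) + L by ring, Complex.cpow_add _ _ hxc,
    Complex.cpow_natCast]
  ring

/-- Orthonormality of the Kirillov vectors in the unitary principal series. -/
theorem kirillov_orthonormality (t : ℝ) (ℓ ℓ' : ℤ) :
    IntegrableOn (fun u : ℝ =>
      Kvec ℓ (Complex.I * (t : ℂ)) u * (starRingEnd ℂ) (Kvec ℓ' (Complex.I * (t : ℂ)) u) /
        ((|u| : ℝ) : ℂ)) {(0 : ℝ)}ᶜ ∧
    (1 / (Real.pi : ℂ)) *
        ∫ u in ({(0 : ℝ)}ᶜ : Set ℝ),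
          Kvec ℓ (Complex.I * (t : ℂ)) u * (starRingEnd ℂ) (Kvec ℓ' (Complex.I * (t : ℂ)) u) /
            ((|u| : ℝ) : ℂ) =
      if ℓ = ℓ' then 1 else 0 := by
  set ν : ℂ := Complex.I * (t : ℂ) with hν_def
  have hν : ν.re = 0 := by simp [hν_def]
  have hG : ∀ ℓ : ℤ, Complex.Gamma (ν + (ℓ.natAbs : ℂ) + 1 / 2) ≠ 0 := fun ℓ =>
    Complex.Gamma_ne_zero_of_re_pos (by simp [hν]; positivity)
  set c : ℂ := (Complex.Gamma (ν + (ℓ.natAbs : ℂ) + 1 / 2) *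
    (starRingEnd ℂ) (Complex.Gamma (ν + (ℓ'.natAbs : ℂ) + 1 / 2)))⁻¹ with hc
  obtain ⟨h1, h2⟩ := integral_mellin_gaussPolyFourier hν hν ℓ.natAbs ℓ'.natAbs (intSign_sq ℓ)
    (intSign_sq ℓ')
  have e1 : Set.EqOn (fun u : ℝ => c * (
      (∫ r in Set.Ioi (0 : ℝ), (r : ℂ) ^ (ν + ℓ.natAbs + 1 / 2 - 1) *
        gaussPolyFourier ℓ.natAbs (intSign ℓ) r u) *
      (starRingEnd ℂ) (∫ r in Set.Ioi (0 : ℝ), (r : ℂ) ^ (ν + ℓ'.natAbs + 1 / 2 - 1) *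
        gaussPolyFourier ℓ'.natAbs (intSign ℓ') r u)))
      (fun u : ℝ => Kvec ℓ ν u * (starRingEnd ℂ) (Kvec ℓ' ν u) / ((|u| : ℝ) : ℂ)) {(0 : ℝ)}ᶜ := by
    intro u hu
    have hu' : 0 < |u| := abs_pos.2 hu
    have huc : ((|u| : ℝ) : ℂ) ≠ 0 := by exact_mod_cast hu'.ne'
    have e : ((|u| : ℝ) : ℂ) ^ (1 / 2 - ν) * (starRingEnd ℂ) (((|u| : ℝ) : ℂ) ^ (1 / 2 - ν)) =
        ((|u| : ℝ) : ℂ) := by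
      rw [Complex.mul_conj', Complex.norm_cpow_eq_rpow_re_of_pos hu', ← Complex.ofReal_pow,
        ← Real.rpow_natCast, ← Real.rpow_mul hu'.le]
      simp [hν]
    simp only [Kvec_eq_integral _ hν hu, map_mul, map_div₀]
    rw [eq_div_iff huc, hc, mul_inv]
    conv_lhs => rw [← e]
    ring
  have hmeas : MeasurableSet ({(0 : ℝ)}ᶜ : Set ℝ) := (measurableSet_singleton 0).compl
  refine ⟨(h1.const_mul c).integrableOn.congr_fun e1 hmeas, ?_⟩
  rw [← setIntegral_congr_fun hmeas e1, volume_restrict_compl_singleton, integral_const_mul, h2]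
  have e2 : ∀ x : ℝ,
      (∫ r in Set.Ioi (0 : ℝ), (r : ℂ) ^ (ν + ℓ.natAbs + 1 / 2 - 1) *
        gaussPoly ℓ.natAbs (intSign ℓ) r x) *
      (starRingEnd ℂ) (∫ r in Set.Ioi (0 : ℝ), (r : ℂ) ^ (ν + ℓ'.natAbs + 1 / 2 - 1) *
        gaussPoly ℓ'.natAbs (intSign ℓ') r x) =
      c⁻¹ * (cayley x ^ (ℓ - ℓ') / (1 + (x : ℂ) ^ 2)) := by
    intro x
    have hx : 0 < 1 + x ^ 2 := by positivity
    have e : ((1 + x ^ 2 : ℝ) : ℂ) ^ (-(ν + 1 / 2)) *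
        (starRingEnd ℂ) (((1 + x ^ 2 : ℝ) : ℂ) ^ (-(ν + 1 / 2))) = (1 + (x : ℂ) ^ 2)⁻¹ := by
      rw [Complex.mul_conj', Complex.norm_cpow_eq_rpow_re_of_pos hx, ← Complex.ofReal_pow,
        ← Real.rpow_natCast, ← Real.rpow_mul hx.le]
      simp [hν, Real.rpow_neg_one]
    rw [integral_cpow_mul_gaussPoly hν, integral_cpow_mul_gaussPoly hν,
      div_eq_mul_inv (_ ^ (ℓ - ℓ')), ← e, zpow_sub₀ (cayley_ne_zero x), hc, inv_inv]
    simp only [map_mul, map_zpow₀, conj_cayley, inv_zpow]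
    ring
  simp_rw [e2]
  have hc0 : c ≠ 0 := inv_ne_zero (mul_ne_zero (hG ℓ) ((map_ne_zero _).2 (hG ℓ')))
  rw [integral_const_mul, integral_cayley_zpow, mul_inv_cancel_left₀ hc0]
  have hpi : (Real.pi : ℂ) ≠ 0 := by exact_mod_cast Real.pi_ne_zero
  by_cases h : ℓ = ℓ'
  · simp [h, hpi]
  · simp [h, sub_eq_zero]
end
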